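/- arXiv:1607.08470 — 2 statements merged into one kernel-verified Lean document; each statement's English description precedes it below -/
import Mathlib

section
/- Suppose condition (HP2) holds. Then every stable weak solution u of −Δ_p u = V|u|^{σ−1}u on ℝ^m vanishes identically, i.e. u = 0 almost everywhere on ℝ^m. -/
open MeasureTheory Real Set Metric Filter
open scoped ENNReal NNReal RealInnerProductSpace

noncomputable section

/-- Euclidean space `ℝ^m`. -/
abbrev Em (m : ℕ) := EuclideanSpace ℝ (Fin m)

/-- A Lipschitz function with compact support. -/
def LipCS {m : ℕ} (φ : Em m → ℝ) : Prop :=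
  (∃ L : ℝ≥0, LipschitzWith L φ) ∧ HasCompactSupport φ

/-- `u` is a weak solution of `-Δ_p u = V |u|^(σ-1) u` on `ℝ^m`:
`u` is `C¹`, `|∇u|^p` and `V |u|^(σ+1)` are locally integrable, and the weak
formulation holds against every Lipschitz test function with compact support. -/
def IsWeakSol {m : ℕ} (p σ : ℝ) (V u : Em m → ℝ) : Prop :=
  ContDiff ℝ 1 u ∧
  LocallyIntegrable (fun x => ‖gradient u x‖ ^ p) volume ∧
  LocallyIntegrable (fun x => V x * |u x| ^ (σ + 1)) volume ∧
  ∀ φ : Em m → ℝ, LipCS φ →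
    (∫ x, ‖gradient u x‖ ^ (p - 2) * ⟪gradient u x, gradient φ x⟫) =
      ∫ x, V x * |u x| ^ (σ - 1) * u x * φ x

/-- Stability of a weak solution `u`. -/
def IsStable {m : ℕ} (p σ : ℝ) (V u : Em m → ℝ) : Prop :=
  ∀ φ : Em m → ℝ, LipCS φ →
    σ * ∫ x, V x * |u x| ^ (σ - 1) * φ x ^ 2 ≤
      (∫ x, ‖gradient u x‖ ^ (p - 2) * ‖gradient φ x‖ ^ 2) +
        (p - 2) * ∫ x, ‖gradient u x‖ ^ (p - 4) * ⟪gradient u x, gradient φ x⟫ ^ 2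

/-- `γ̄ = (2σ - p + 1 + 2√(σ(σ - p + 1)))/(p - 1)`. -/
def gammaBar (p σ : ℝ) : ℝ := (2 * σ - p + 1 + 2 * Real.sqrt (σ * (σ - p + 1))) / (p - 1)

/-- `α = p (σ + γ̄)/(σ - p + 1)`. -/
def alphaC (p σ : ℝ) : ℝ := p * (σ + gammaBar p σ) / (σ - p + 1)

/-- `β = (γ̄ + p - 1)/(σ - p + 1)`. -/
def betaC (p σ : ℝ) : ℝ := (gammaBar p σ + p - 1) / (σ - p + 1)

/-- The critical exponent `σ_c(m, p)`. -/
def sigmaC (mr p : ℝ) : ℝ :=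
  (((p - 1) * mr - p) ^ 2 + p ^ 2 * (p - 2) - p ^ 2 * (p - 1) * mr +
      2 * p ^ 2 * Real.sqrt ((p - 1) * (mr - 1))) /
    ((mr - p) * ((p - 1) * mr - p * (p + 3)))

/-- Condition (HP1). -/
def HP1 {m : ℕ} (p σ : ℝ) (V : Em m → ℝ) : Prop :=
  ∃ C C₀ R₀ ε₀ : ℝ, 0 < C ∧ 0 < C₀ ∧ 0 < R₀ ∧ 0 < ε₀ ∧
    ∀ ε ∈ Set.Ioo (0 : ℝ) ε₀, ∀ R > R₀,
      (∫⁻ x in Metric.ball (0 : Em m) R \ Metric.ball (0 : Em m) (R / 2),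
          ENNReal.ofReal (V x ^ (-(betaC p σ) + ε))) ≤
        ENNReal.ofReal (C * R ^ (alphaC p σ + C₀ * ε) * (Real.log R)⁻¹)

/-- Condition (HP2). -/
def HP2 {m : ℕ} (p σ : ℝ) (V : Em m → ℝ) : Prop :=
  ∃ C C₀ R₀ ε₀ θ b : ℝ, 0 < C ∧ 0 < C₀ ∧ 0 < R₀ ∧ 0 < ε₀ ∧ 0 < θ ∧
    b < -1 + θ / (σ - p + 1) ∧
    ∀ ε ∈ Set.Ioo (0 : ℝ) ε₀, ∀ R > R₀,
      (∫⁻ x in Metric.ball (0 : Em m) R \ Metric.ball (0 : Em m) (R / 2),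
          ENNReal.ofReal (V x ^ (-(betaC p σ) + ε))) ≤
        ENNReal.ofReal (C * R ^ (alphaC p σ + C₀ * ε) * Real.log R ^ b *
          Real.exp (-θ * ε * Real.log (R / 2) * Real.log (Real.log (R / 2))))

/-! ### Pointwise inequalities -/

lemma interpolate_le {p s X Y : ℝ} (hp : 2 ≤ p) (hs : 0 < s) (hs1 : s ≤ 1)
    (hX : 0 ≤ X) (hY : 0 ≤ Y) :
    X ^ (p - 2) * X * Y ≤ s * (X ^ (p - 2) * X ^ 2) + s ^ (1 - p) * Y ^ p ∧
      X ^ (p - 2) * Y ^ 2 ≤ s * (X ^ (p - 2) * X ^ 2) + s ^ (1 - p) * Y ^ p := by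
  have hXp : 0 ≤ X ^ (p - 2) := rpow_nonneg hX _
  have hYp : 0 ≤ s ^ (1 - p) * Y ^ p := by positivity
  rcases le_or_gt Y (s * X) with h | h
  · have h1 : X * Y ≤ s * X ^ 2 := by nlinarith
    have h2 : Y ^ 2 ≤ s * X ^ 2 := by
      have : Y ^ 2 ≤ (s * X) ^ 2 := by gcongr
      nlinarith [sq_nonneg X, mul_nonneg hs.le (sq_nonneg X)]
    constructor
    · nlinarith [mul_le_mul_of_nonneg_left h1 hXp]
    · nlinarith [mul_le_mul_of_nonneg_left h2 hXp]
  · have hY0 : 0 < Y := lt_of_le_of_lt (by positivity) h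
    have hXY : X ≤ Y / s := by rw [le_div_iff₀ hs]; linarith
    have hpow : X ^ (p - 2) ≤ (Y / s) ^ (p - 2) := rpow_le_rpow hX hXY (by linarith)
    have e1 : (Y / s) ^ (p - 2) * (Y / s) * Y = s ^ (1 - p) * Y ^ p := by
      have a1 : Y ^ p = Y ^ (p - 2) * Y * Y := by
        rw [mul_assoc, ← pow_two, ← rpow_natCast, ← rpow_add hY0]; norm_num
      have a2 : s ^ (1 - p) = (s ^ (p - 2) * s)⁻¹ := by
        rw [← rpow_add_one hs.ne', ← rpow_neg hs.le]; ring_nf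
      rw [a1, a2, div_rpow hY hs.le]
      have : s ^ (p - 2) ≠ 0 := (rpow_pos_of_pos hs _).ne'
      field_simp
    have hnn : 0 ≤ s * (X ^ (p - 2) * X ^ 2) := by positivity
    constructor
    · calc X ^ (p - 2) * X * Y ≤ (Y / s) ^ (p - 2) * (Y / s) * Y := by gcongr
        _ = _ := e1
        _ ≤ _ := by linarith
    · have hYs : Y ≤ Y / s := by rw [le_div_iff₀ hs]; nlinarith
      calc X ^ (p - 2) * Y ^ 2 = X ^ (p - 2) * Y * Y := by ring
        _ ≤ (Y / s) ^ (p - 2) * (Y / s) * Y := by gcongr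
        _ = _ := e1
        _ ≤ _ := by linarith

lemma weighted_interpolate_le {p s g U P t w : ℝ} {j : ℕ} (hp : 2 ≤ p) (hj : p ≤ 2 * j + 2)
    (hs : 0 < s) (hs1 : s ≤ 1) (hg : 0 ≤ g) (hU : 0 ≤ U) (hP : 0 ≤ P) (ht : 0 ≤ t) (hw : 0 ≤ w) :
    w * t ^ (2 * j + 1) * g ^ (p - 2) * g * U * P ≤
        s * (w * t ^ (2 * j + 2) * g ^ (p - 2) * g ^ 2) +
          s ^ (1 - p) * (w * t ^ ((2 * j + 2 : ℝ) - p) * U ^ p * P ^ p) ∧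
      w * t ^ (2 * j) * g ^ (p - 2) * U ^ 2 * P ^ 2 ≤
        s * (w * t ^ (2 * j + 2) * g ^ (p - 2) * g ^ 2) +
          s ^ (1 - p) * (w * t ^ ((2 * j + 2 : ℝ) - p) * U ^ p * P ^ p) := by
  have h := interpolate_le hp hs hs1 (mul_nonneg hg ht) (mul_nonneg hU hP)
  have e : t ^ (2 * j) = t ^ ((2 * j + 2 : ℝ) - p) * t ^ (p - 2) := by
    rw [← rpow_add_of_nonneg ht (by linarith) (by linarith), ← rpow_natCast]
    congr 1; push_cast; ring
  rw [mul_rpow hg ht, mul_rpow hU hP] at h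
  have hw' : 0 ≤ w * t ^ ((2 * j + 2 : ℝ) - p) := by positivity
  have h1 := mul_le_mul_of_nonneg_left h.1 hw'
  have h2 := mul_le_mul_of_nonneg_left h.2 hw'
  simp only [pow_succ t (2 * j), pow_succ t (2 * j + 1), e]
  constructor
  · linear_combination h1
  · linear_combination h2

lemma absorb_le {p τ e η v U P t : ℝ} {j : ℕ} (hp : 2 ≤ p) (hτ : 0 < τ) (he : 0 ≤ e)
    (hj : p * (1 + e) ≤ 2 * j + 2) (hη : 0 < η) (hv : 0 < v) (hU : 0 ≤ U) (hP : 0 ≤ P)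
    (ht : 0 ≤ t) (ht1 : t ≤ 1) :
    U ^ (τ * e) * t ^ ((2 * j + 2 : ℝ) - p) * P ^ p ≤
      η * (v * U ^ (τ + τ * e) * t ^ (2 * j + 2)) + η ^ (-e) * (v ^ (-e) * P ^ (p * (1 + e))) := by
  have hpe : 0 ≤ p * e := by positivity
  have hUe : 0 ≤ U ^ (τ * e) := rpow_nonneg hU _
  have htk : 0 ≤ t ^ ((2 * j + 2 : ℝ) - p) := rpow_nonneg ht _
  rcases le_or_gt (P ^ p) (η * v * U ^ τ * t ^ p) with h | h
  · have e1 : t ^ (2 * j + 2) = t ^ ((2 * j + 2 : ℝ) - p) * t ^ p := by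
      rw [← rpow_add_of_nonneg ht (by linarith) (by linarith), ← rpow_natCast]
      congr 1; push_cast; ring
    have e2 : U ^ (τ + τ * e) = U ^ τ * U ^ (τ * e) :=
      rpow_add_of_nonneg hU hτ.le (by positivity)
    have hnn : 0 ≤ η ^ (-e) * (v ^ (-e) * P ^ (p * (1 + e))) := by positivity
    have := mul_le_mul_of_nonneg_left h (mul_nonneg hUe htk)
    rw [e1, e2]
    linear_combination this + hnn
  · have h1 : (η * v * U ^ τ * t ^ p) ^ e ≤ (P ^ p) ^ e := rpow_le_rpow (by positivity) h.le he
    rw [mul_rpow (by positivity) (by positivity), mul_rpow (by positivity) (by positivity),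
      mul_rpow hη.le hv.le, ← rpow_mul hU, ← rpow_mul ht, ← rpow_mul hP] at h1
    have h2 : t ^ ((2 * j + 2 : ℝ) - p) ≤ t ^ (p * e) :=
      rpow_le_rpow_of_exponent_ge' ht ht1 hpe (by linarith)
    have e1 : P ^ (p * (1 + e)) = P ^ (p * e) * P ^ p := by
      rw [← rpow_add_of_nonneg hP hpe (by linarith)]; ring_nf
    have hη' : 0 < η ^ e := rpow_pos_of_pos hη _
    have hv' : 0 < v ^ e := rpow_pos_of_pos hv _
    have h3 : U ^ (τ * e) * t ^ (p * e) ≤ η ^ (-e) * (v ^ (-e) * P ^ (p * e)) := by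
      rw [rpow_neg hη.le, rpow_neg hv.le, ← mul_assoc, ← mul_inv, inv_mul_eq_div,
        le_div_iff₀ (by positivity)]
      linarith
    have hnn : 0 ≤ η * (v * U ^ (τ + τ * e) * t ^ (2 * j + 2)) := by positivity
    calc U ^ (τ * e) * t ^ ((2 * j + 2 : ℝ) - p) * P ^ p
        ≤ U ^ (τ * e) * t ^ (p * e) * P ^ p := by gcongr
      _ ≤ η ^ (-e) * (v ^ (-e) * P ^ (p * e)) * P ^ p := by gcongr
      _ = η ^ (-e) * (v ^ (-e) * P ^ (p * (1 + e))) := by rw [e1]; ring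
      _ ≤ _ := by linarith

/-! ### The exponents and the absorption argument -/

lemma one_lt_gammaBar {p σ : ℝ} (hp : 2 ≤ p) (hσ : p - 1 < σ) : 1 < gammaBar p σ := by
  rw [gammaBar, lt_div_iff₀ (by linarith)]
  have := Real.sqrt_nonneg (σ * (σ - p + 1))
  linarith

lemma betaC_pos {p σ : ℝ} (hp : 2 ≤ p) (hσ : p - 1 < σ) : 0 < betaC p σ := by
  have := one_lt_gammaBar hp hσ
  exact div_pos (by linarith) (by linarith)

lemma alphaC_eq {p σ : ℝ} (hσ : p - 1 < σ) : alphaC p σ = p * (1 + betaC p σ) := by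
  have : σ - p + 1 ≠ 0 := by linarith
  rw [alphaC, betaC]
  field_simp
  ring

lemma gammaBar_sub_eq {p σ : ℝ} (hσ : p - 1 < σ) (ε : ℝ) :
    gammaBar p σ - ε * (σ - p + 1) = (σ - p + 1) * (betaC p σ - ε) - (p - 1) := by
  have : σ - p + 1 ≠ 0 := by linarith
  rw [betaC]
  field_simp
  ring

lemma stability_gap {p σ δ : ℝ} (hp : 2 ≤ p) (hσ : p - 1 < σ) :
    σ * (gammaBar p σ - δ) - (p - 1) * ((gammaBar p σ - δ + 1) ^ 2 / 4) =
      δ * (√(σ * (σ - p + 1)) - (p - 1) * δ / 4) := by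
  have hS : √(σ * (σ - p + 1)) ^ 2 = σ * (σ - p + 1) :=
    Real.sq_sqrt (mul_nonneg (by linarith) (by linarith))
  have hp1 : p - 1 ≠ 0 := by linarith
  rw [gammaBar]
  field_simp
  linear_combination (-4) * hS

set_option maxHeartbeats 1000000 in
lemma exists_absorption_constant {p σ k : ℝ} (hp : 2 ≤ p) (hσ : p - 1 < σ) (hk : 0 < k) :
    ∃ ε₁ > 0, ∃ c > 0, ∀ ε ∈ Ioo (0 : ℝ) ε₁,
      1 < gammaBar p σ - ε * (σ - p + 1) ∧ ε ≤ betaC p σ ∧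
      ∀ γ A B D W : ℝ, γ = gammaBar p σ - ε * (σ - p + 1) → 0 ≤ A → 0 ≤ B → 0 ≤ D → 0 ≤ W →
        (∀ s ∈ Ioc (0 : ℝ) 1, γ * A ≤ B + k * (s * A + s ^ (1 - p) * D)) →
        (∀ s ∈ Ioc (0 : ℝ) 1, σ * B ≤ (p - 1) * ((γ + 1) ^ 2 / 4 * A +
          ((γ + 1) * k / 2 + k ^ 2 / 4) * (s * A + s ^ (1 - p) * D))) →
        (∀ η > 0, D ≤ η * B + η ^ (-(betaC p σ - ε)) * W) →
        B ≤ (c * ε ^ p) ^ (-(1 + betaC p σ)) * W := by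
  have hγ := one_lt_gammaBar hp hσ
  have hβ := betaC_pos hp hσ
  set G := gammaBar p σ with hG
  set β := betaC p σ
  have hτ : 0 < σ - p + 1 := by linarith
  set τ := σ - p + 1 with hτdef
  have hσ0 : 0 < σ := by linarith
  have hp1 : 0 < p - 1 := by linarith
  have hS : 0 < √(σ * τ) := Real.sqrt_pos.2 (by positivity)
  set S := √(σ * τ) with hSdef
  set K₀ := (G + 1) * k / 2 + k ^ 2 / 4 with hK₀
  have hK₀pos : 0 < K₀ := by positivity
  set M₁ := σ * k + (p - 1) * K₀ with hM₁
  have hM₁pos : 0 < M₁ := by positivity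
  set c₀ := τ * S / 2 with hc₀
  have hc₀pos : 0 < c₀ := by positivity
  set c₁ := c₀ / (2 * M₁) with hc₁
  have hc₁pos : 0 < c₁ := by positivity
  set K₃ := 1 + (p - 1) / σ * ((G + 1) ^ 2 / 4 + 2 * K₀) with hK₃
  have hK₃1 : 1 ≤ K₃ := by
    have : 0 ≤ (p - 1) / σ * ((G + 1) ^ 2 / 4 + 2 * K₀) := by positivity
    linarith
  refine ⟨min (min ((G - 1) / τ) (2 * S / ((p - 1) * τ))) (min β (1 / c₁)), ?_,
    c₁ ^ p / (2 * K₃), by positivity, ?_⟩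
  · have : 0 < G - 1 := by linarith
    positivity
  rintro ε ⟨hε, hε'⟩
  simp only [lt_min_iff] at hε'
  obtain ⟨⟨hε1, hε2⟩, hε3, hε4⟩ := hε'
  rw [lt_div_iff₀ hτ] at hε1
  rw [lt_div_iff₀ (by positivity)] at hε2
  rw [lt_div_iff₀ hc₁pos] at hε4
  refine ⟨by linarith, hε3.le, ?_⟩
  intro γ A B D W hγeq hA hB hD hW h1 h2 h3
  have hγ1 : 1 < γ := by linarith
  have hετ : 0 < ε * τ := by positivity
  have hγG : γ ≤ G := by linarith
  set s := c₁ * ε with hs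
  have hs0 : 0 < s := by positivity
  have hs1 : s ≤ 1 := by linarith
  replace h1 := h1 s ⟨hs0, hs1⟩
  replace h2 := h2 s ⟨hs0, hs1⟩
  set E := s ^ (1 - p) * D with hE
  have hE0 : 0 ≤ E := by positivity
  have hgap : c₀ * ε ≤ σ * γ - (p - 1) * ((γ + 1) ^ 2 / 4) := by
    rw [hγeq, hG, stability_gap hp hσ, ← hτdef, ← hSdef, hc₀]
    have : S / 2 ≤ S - (p - 1) * (ε * τ) / 4 := by linarith
    linear_combination mul_le_mul_of_nonneg_left this hετ.le
  have hsAE : 0 ≤ s * A + E := by positivity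
  have hKγ : ((γ + 1) * k / 2 + k ^ 2 / 4) * (s * A + E) ≤ K₀ * (s * A + E) := by
    rw [hK₀]; gcongr
  have h2' : σ * B ≤ (p - 1) * ((γ + 1) ^ 2 / 4 * A + K₀ * (s * A + E)) :=
    h2.trans (by gcongr)
  have hM₁s : c₀ * ε = 2 * (M₁ * s) := by rw [hs, hc₁]; field_simp
  have hsA : s * A ≤ E := by
    have a1 : c₀ * ε * A ≤ M₁ * (s * A + E) := by
      have b1 := mul_le_mul_of_nonneg_left h1 hσ0.le
      have b2 := mul_le_mul_of_nonneg_right hgap hA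
      rw [hM₁]
      linarith
    rw [hM₁s] at a1
    have : M₁ * (s * A) ≤ M₁ * E := by linarith
    exact le_of_mul_le_mul_left this hM₁pos
  set F := s ^ (-p) * D with hF
  have hF0 : 0 ≤ F := by positivity
  have hsF : s * F = E := by
    rw [hF, hE, ← mul_assoc, sub_eq_add_neg, rpow_add hs0, rpow_one]
  have hAF : A ≤ F := by
    rw [← hsF] at hsA
    exact le_of_mul_le_mul_left hsA hs0
  have hEF : E ≤ F := by rw [← hsF]; exact mul_le_of_le_one_left hF0 hs1
  have hBF : B ≤ K₃ * F := by
    have : σ * B ≤ (p - 1) * ((G + 1) ^ 2 / 4 * F + K₀ * (F + F)) := by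
      refine h2'.trans ?_
      gcongr
      linarith
    have b : B ≤ (p - 1) / σ * ((G + 1) ^ 2 / 4 + 2 * K₀) * F := by
      rw [div_mul_eq_mul_div, div_mul_eq_mul_div, le_div_iff₀ hσ0]
      linarith
    rw [hK₃]
    linarith
  have hη : c₁ ^ p / (2 * K₃) * ε ^ p = s ^ p / (2 * K₃) := by
    rw [hs, mul_rpow hc₁pos.le hε.le]; ring
  rw [hη]
  set η := s ^ p / (2 * K₃) with hηdef
  have hsp : 0 < s ^ p := rpow_pos_of_pos hs0 _
  have hη0 : 0 < η := by positivity
  have hη1 : η ≤ 1 := by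
    have : s ^ p ≤ 1 := rpow_le_one hs0.le hs1 (by linarith)
    rw [hηdef, div_le_one (by positivity)]
    linarith
  have hηK : K₃ * s ^ (-p) = η⁻¹ / 2 := by
    rw [hηdef, rpow_neg hs0.le]; field_simp
  have h3' := h3 η hη0
  have hexp : η ^ (-(β - ε)) ≤ η ^ (-β) :=
    rpow_le_rpow_of_exponent_ge hη0 hη1 (by linarith)
  have hBD : B ≤ η⁻¹ / 2 * D := by rw [← hηK, mul_assoc]; exact hBF
  have hfin : B ≤ η⁻¹ / 2 * (η * B + η ^ (-β) * W) :=
    hBD.trans (mul_le_mul_of_nonneg_left (h3'.trans (by gcongr)) (by positivity))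
  have e1 : η⁻¹ / 2 * (η * B) = B / 2 := by field_simp
  have e2 : η ^ (-(1 + β)) = η⁻¹ * η ^ (-β) := by
    rw [neg_add, rpow_add hη0, rpow_neg_one]
  rw [e2]
  linarith

/-! ### Gradients of the test functions -/

lemma hasDerivAt_abs_rpow_mul_self {a : ℝ} (ha : 0 < a) (t : ℝ) :
    HasDerivAt (fun t : ℝ => |t| ^ a * t) ((a + 1) * |t| ^ a) t := by
  have hcont : Continuous fun t : ℝ => |t| ^ a := continuous_abs.rpow_const fun _ => Or.inr ha.le
  have hne : ∀ y : ℝ, y ≠ 0 → HasDerivAt (fun t : ℝ => |t| ^ a * t) ((a + 1) * |y| ^ a) y := by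
    intro y hy
    have hy' : |y| ≠ 0 := abs_ne_zero.2 hy
    have h := ((hasDerivAt_abs hy).rpow_const (p := a) (Or.inl hy')).mul (hasDerivAt_id y)
    refine h.congr_deriv ?_
    have e : |y| ^ a = |y| ^ (a - 1) * |y| := by rw [← rpow_add_one hy']; ring_nf
    simp only [id, mul_one]
    rw [e]
    have := sign_mul_self y
    linear_combination (a * |y| ^ (a - 1)) * this
  rcases eq_or_ne t 0 with rfl | ht
  · exact hasDerivAt_of_hasDerivAt_of_ne hne (hcont.mul continuous_id).continuousAt
      (continuous_const.mul hcont).continuousAt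
  · exact hne t ht

lemma contDiff_abs_rpow_mul_self {a : ℝ} (ha : 0 < a) :
    ContDiff ℝ 1 fun t : ℝ => |t| ^ a * t := by
  rw [contDiff_one_iff_deriv]
  refine ⟨fun t => (hasDerivAt_abs_rpow_mul_self ha t).differentiableAt, ?_⟩
  rw [show deriv (fun t : ℝ => |t| ^ a * t) = fun t => (a + 1) * |t| ^ a from
    funext fun t => (hasDerivAt_abs_rpow_mul_self ha t).deriv]
  exact continuous_const.mul (continuous_abs.rpow_const fun _ => Or.inr ha.le)

/-- The test function `|u|^a u ψ^(n+1)`. -/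
def testFun {m : ℕ} (a : ℝ) (n : ℕ) (u ψ : Em m → ℝ) (x : Em m) : ℝ :=
  |u x| ^ a * u x * ψ x ^ (n + 1)

section

variable {m : ℕ} {u ψ : Em m → ℝ} {a : ℝ}

lemma continuous_gradient (hu : ContDiff ℝ 1 u) : Continuous (gradient u) :=
  (InnerProductSpace.toDual ℝ (Em m)).symm.continuous.comp (hu.continuous_fderiv one_ne_zero)

lemma contDiff_testFun (ha : 0 < a) (n : ℕ) (hu : ContDiff ℝ 1 u) (hψ : ContDiff ℝ 1 ψ) :
    ContDiff ℝ 1 (testFun a n u ψ) :=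
  ((contDiff_abs_rpow_mul_self ha).comp hu).mul (hψ.pow _)

lemma hasCompactSupport_testFun (a : ℝ) (n : ℕ) (u : Em m → ℝ) (hψc : HasCompactSupport ψ) :
    HasCompactSupport (testFun a n u ψ) :=
  (hψc.comp_left (g := fun t : ℝ => t ^ (n + 1)) (by simp)).mul_left

lemma lipCS_of_contDiff (hψ : ContDiff ℝ 1 ψ) (hψc : HasCompactSupport ψ) : LipCS ψ :=
  ⟨hψ.lipschitzWith_of_hasCompactSupport hψc one_ne_zero, hψc⟩

lemma gradient_testFun (ha : 0 < a) (n : ℕ) (hu : ContDiff ℝ 1 u) (hψ : ContDiff ℝ 1 ψ)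
    (x : Em m) :
    gradient (testFun a n u ψ) x = ((a + 1) * |u x| ^ a * ψ x ^ (n + 1)) • gradient u x +
      ((n + 1) * |u x| ^ a * u x * ψ x ^ n) • gradient ψ x := by
  have hu' := (hu.differentiable one_ne_zero x).hasFDerivAt
  have hψ' := (hψ.differentiable one_ne_zero x).hasFDerivAt
  have h := ((hasDerivAt_abs_rpow_mul_self ha (u x)).comp_hasFDerivAt x hu').mul (hψ'.pow (n + 1))
  have h' : HasFDerivAt (testFun a n u ψ) _ x := h
  rw [gradient, h'.fderiv]
  simp only [map_add, map_smul, Function.comp_apply, smul_smul, gradient, Nat.add_sub_cancel,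
    nsmul_eq_mul]
  rw [add_comm]
  congr 2
  · ring
  · push_cast
    ring

end

/-! ### Integral estimates -/

/-- The integrand `|u|^(γ-1) ψ^(2j+2) |∇u|^p`. -/
def gradDensity {m : ℕ} (p γ : ℝ) (j : ℕ) (u ψ : Em m → ℝ) (x : Em m) : ℝ :=
  |u x| ^ (γ - 1) * ψ x ^ (2 * j + 2) * ‖gradient u x‖ ^ (p - 2) * ‖gradient u x‖ ^ 2

/-- The integrand `V |u|^(σ+γ) ψ^(2j+2)`. -/
def potDensity {m : ℕ} (σ γ : ℝ) (j : ℕ) (V u ψ : Em m → ℝ) (x : Em m) : ℝ :=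
  V x * |u x| ^ (σ + γ) * ψ x ^ (2 * j + 2)

/-- The integrand `|u|^(γ-1+p) ψ^(2j+2-p) |∇ψ|^p`. -/
def cutoffDensity {m : ℕ} (p γ : ℝ) (j : ℕ) (u ψ : Em m → ℝ) (x : Em m) : ℝ :=
  |u x| ^ (γ - 1) * ψ x ^ ((2 * j + 2 : ℝ) - p) * |u x| ^ p * ‖gradient ψ x‖ ^ p

section

variable {m : ℕ} {p σ γ s : ℝ} {j : ℕ} {V u ψ : Em m → ℝ}

lemma integrable_gradDensity (hp : 2 ≤ p) (hγ : 1 < γ) (hu : ContDiff ℝ 1 u)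
    (hψ : ContDiff ℝ 1 ψ) (hψc : HasCompactSupport ψ) :
    Integrable (gradDensity p γ j u ψ) := by
  have h1 : Continuous fun x => |u x| ^ (γ - 1) :=
    hu.continuous.abs.rpow_const fun _ => Or.inr (by linarith)
  have h2 : Continuous fun x => ‖gradient u x‖ ^ (p - 2) :=
    (continuous_gradient hu).norm.rpow_const fun _ => Or.inr (by linarith)
  have hc : HasCompactSupport fun x => ψ x ^ (2 * j + 2) :=
    hψc.comp_left (g := fun t : ℝ => t ^ (2 * j + 2)) (by simp)
  exact (((h1.mul (hψ.continuous.pow _)).mul h2).mul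
    ((continuous_gradient hu).norm.pow 2)).integrable_of_hasCompactSupport
      (hc.mul_left.mul_right.mul_right)

lemma integrable_cutoffDensity (hp : 2 ≤ p) (hγ : 1 < γ) (hj : p < 2 * j + 2)
    (hu : ContDiff ℝ 1 u) (hψ : ContDiff ℝ 1 ψ) (hψc : HasCompactSupport ψ) :
    Integrable (cutoffDensity p γ j u ψ) := by
  have h1 : Continuous fun x => |u x| ^ (γ - 1) :=
    hu.continuous.abs.rpow_const fun _ => Or.inr (by linarith)
  have h2 : Continuous fun x => ‖gradient ψ x‖ ^ p :=
    (continuous_gradient hψ).norm.rpow_const fun _ => Or.inr (by linarith)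
  have h3 : Continuous fun x => |u x| ^ p :=
    hu.continuous.abs.rpow_const fun _ => Or.inr (by linarith)
  have h4 : Continuous fun x => ψ x ^ ((2 * j + 2 : ℝ) - p) :=
    hψ.continuous.rpow_const fun _ => Or.inr (by linarith)
  have hc : HasCompactSupport fun x => ψ x ^ ((2 * j + 2 : ℝ) - p) :=
    hψc.comp_left (g := fun t : ℝ => t ^ ((2 * j + 2 : ℝ) - p)) (zero_rpow (by linarith))
  exact (((h1.mul h4).mul h3).mul h2).integrable_of_hasCompactSupport
      (hc.mul_left.mul_right.mul_right)

lemma integrable_potDensity (hσγ : 0 ≤ σ + γ) (hV : LocallyIntegrable V)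
    (hu : Continuous u) (hψ : Continuous ψ) (hψc : HasCompactSupport ψ) :
    Integrable (potDensity σ γ j V u ψ) := by
  have h1 : Continuous fun x => |u x| ^ (σ + γ) := hu.abs.rpow_const fun _ => Or.inr hσγ
  have hc : HasCompactSupport fun x => ψ x ^ (2 * j + 2) :=
    hψc.comp_left (g := fun t : ℝ => t ^ (2 * j + 2)) (by simp)
  have := hV.integrable_smul_left_of_hasCompactSupport (h1.mul (hψ.pow (2 * j + 2))) hc.mul_left
  refine this.congr (Eventually.of_forall fun x => ?_)
  simp only [potDensity, smul_eq_mul, Pi.mul_apply, Pi.pow_apply]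
  ring

lemma integrable_gradDensity_add_cutoffDensity (hp : 2 ≤ p) (hγ : 1 < γ) (hj : p < 2 * j + 2)
    (hu : ContDiff ℝ 1 u) (hψ : ContDiff ℝ 1 ψ) (hψc : HasCompactSupport ψ) (a b : ℝ) :
    Integrable (fun x => a * gradDensity p γ j u ψ x + b * cutoffDensity p γ j u ψ x) :=
  ((integrable_gradDensity hp hγ hu hψ hψc).const_mul a).add
    ((integrable_cutoffDensity hp hγ hj hu hψ hψc).const_mul b)

lemma integral_gradDensity_add_cutoffDensity (hp : 2 ≤ p) (hγ : 1 < γ) (hj : p < 2 * j + 2)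
    (hu : ContDiff ℝ 1 u) (hψ : ContDiff ℝ 1 ψ) (hψc : HasCompactSupport ψ) (a b : ℝ) :
    ∫ x, (a * gradDensity p γ j u ψ x + b * cutoffDensity p γ j u ψ x) =
      a * (∫ x, gradDensity p γ j u ψ x) + b * ∫ x, cutoffDensity p γ j u ψ x := by
  rw [integral_add ((integrable_gradDensity hp hγ hu hψ hψc).const_mul a)
    ((integrable_cutoffDensity hp hγ hj hu hψ hψc).const_mul b), integral_const_mul,
    integral_const_mul]

lemma abs_rpow_add_mul_sq {t : ℝ} (hσ : 1 ≤ σ) (hγ : 1 < γ) :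
    |t| ^ (σ + γ) = |t| ^ (σ - 1) * |t| ^ (γ - 1) * t ^ 2 := by
  rw [← sq_abs t, ← rpow_natCast, ← rpow_add_of_nonneg (abs_nonneg t) (by linarith) (by linarith),
    ← rpow_add_of_nonneg (abs_nonneg t) (by linarith) (by positivity)]
  congr 1
  push_cast
  ring

lemma IsWeakSol.gradDensity_le (hp : 2 ≤ p) (hσ : 1 ≤ σ) (hγ : 1 < γ) (hj : p < 2 * j + 2)
    (hs : 0 < s) (hs1 : s ≤ 1) (hu : IsWeakSol p σ V u)
    (hψ : ContDiff ℝ 1 ψ) (hψc : HasCompactSupport ψ) (hψ0 : ∀ x, 0 ≤ ψ x) :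
    γ * ∫ x, gradDensity p γ j u ψ x ≤ (∫ x, potDensity σ γ j V u ψ x) +
      (2 * j + 2) * (s * (∫ x, gradDensity p γ j u ψ x) +
        s ^ (1 - p) * ∫ x, cutoffDensity p γ j u ψ x) := by
  obtain ⟨hu1, -, -, hw⟩ := hu
  have ha : 0 < γ - 1 := by linarith
  have hφ := contDiff_testFun ha (2 * j + 1) hu1 hψ
  have hφc := hasCompactSupport_testFun (γ - 1) (2 * j + 1) u hψc
  have hgc : HasCompactSupport (gradient (testFun (γ - 1) (2 * j + 1) u ψ)) :=
    (hφc.fderiv ℝ).comp_left (map_zero (InnerProductSpace.toDual ℝ (Em m)).symm)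
  have hI : Integrable fun x => ‖gradient u x‖ ^ (p - 2) *
      ⟪gradient u x, gradient (testFun (γ - 1) (2 * j + 1) u ψ) x⟫ := by
    refine Continuous.integrable_of_hasCompactSupport ?_ ?_
    · exact ((continuous_gradient hu1).norm.rpow_const fun _ => Or.inr (by linarith)).mul
        ((continuous_gradient hu1).inner (continuous_gradient hφ))
    · refine HasCompactSupport.mul_left ?_
      exact hgc.mono fun x hx h => hx (by simp [h])
  have hrhs : (∫ x, V x * |u x| ^ (σ - 1) * u x * testFun (γ - 1) (2 * j + 1) u ψ x) =
      ∫ x, potDensity σ γ j V u ψ x := by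
    refine integral_congr_ae (Eventually.of_forall fun x => ?_)
    simp only [testFun, potDensity, abs_rpow_add_mul_sq hσ hγ]
    ring
  have hw' := hw _ (lipCS_of_contDiff hφ hφc)
  rw [hrhs] at hw'
  have hle : ∫ x, ((γ - (2 * j + 2) * s) * gradDensity p γ j u ψ x +
      (-(2 * j + 2) * s ^ (1 - p)) * cutoffDensity p γ j u ψ x) ≤
        ∫ x, potDensity σ γ j V u ψ x := by
    rw [← hw']
    refine integral_mono
      (integrable_gradDensity_add_cutoffDensity hp hγ hj hu1 hψ hψc _ _) hI fun x => ?_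
    have hY := (weighted_interpolate_le hp hj.le hs hs1 (norm_nonneg (gradient u x))
      (abs_nonneg (u x)) (norm_nonneg (gradient ψ x)) (hψ0 x)
      (rpow_nonneg (abs_nonneg (u x)) (γ - 1))).1
    have hCS : -(|u x| * (‖gradient u x‖ * ‖gradient ψ x‖)) ≤
        u x * ⟪gradient u x, gradient ψ x⟫ := by
      refine (neg_le_neg ?_).trans (neg_abs_le _)
      rw [abs_mul]
      gcongr
      exact abs_real_inner_le_norm _ _
    have hc : 0 ≤ (2 * j + 2 : ℝ) *
        (‖gradient u x‖ ^ (p - 2) * |u x| ^ (γ - 1) * ψ x ^ (2 * j + 1)) := by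
      have := hψ0 x
      positivity
    have h1 := mul_le_mul_of_nonneg_left hCS hc
    have h2 := mul_le_mul_of_nonneg_left hY (show (0 : ℝ) ≤ 2 * j + 2 by positivity)
    simp only [gradient_testFun ha (2 * j + 1) hu1 hψ, inner_add_right, inner_smul_right,
      real_inner_self_eq_norm_sq, gradDensity, cutoffDensity]
    push_cast
    linear_combination h1 + h2
  rw [integral_gradDensity_add_cutoffDensity hp hγ hj hu1 hψ hψc] at hle
  linarith

lemma IsStable.le_integral (hp : 2 ≤ p) (hu : ContDiff ℝ 1 u) (hst : IsStable p σ V u)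
    {φ : Em m → ℝ} (hφ : ContDiff ℝ 1 φ) (hφc : HasCompactSupport φ) :
    σ * ∫ x, V x * |u x| ^ (σ - 1) * φ x ^ 2 ≤
      (p - 1) * ∫ x, ‖gradient u x‖ ^ (p - 2) * ‖gradient φ x‖ ^ 2 := by
  have hgc : HasCompactSupport (gradient φ) :=
    (hφc.fderiv ℝ).comp_left (map_zero (InnerProductSpace.toDual ℝ (Em m)).symm)
  have hI : Integrable fun x => ‖gradient u x‖ ^ (p - 2) * ‖gradient φ x‖ ^ 2 := by
    refine Continuous.integrable_of_hasCompactSupport ?_ ?_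
    · exact ((continuous_gradient hu).norm.rpow_const fun _ => Or.inr (by linarith)).mul
        ((continuous_gradient hφ).norm.pow 2)
    · refine HasCompactSupport.mul_left ?_
      exact hgc.mono fun x hx h => hx (by simp [h])
  have hle : ∫ x, ‖gradient u x‖ ^ (p - 4) * ⟪gradient u x, gradient φ x⟫ ^ 2 ≤
      ∫ x, ‖gradient u x‖ ^ (p - 2) * ‖gradient φ x‖ ^ 2 := by
    refine integral_mono_of_nonneg (Eventually.of_forall fun x => by positivity) hI
      (Eventually.of_forall fun x => ?_)
    rcases eq_or_ne (gradient u x) 0 with h | h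
    · simp only [h, inner_zero_left, norm_zero]
      have : (0 : ℝ) ≤ 0 ^ (p - 2) := rpow_nonneg le_rfl _
      simp only [ne_eq, OfNat.ofNat_ne_zero, not_false_eq_true, zero_pow, mul_zero]
      positivity
    · have hn : 0 < ‖gradient u x‖ := norm_pos_iff.2 h
      have e : ‖gradient u x‖ ^ (p - 2) = ‖gradient u x‖ ^ (p - 4) * ‖gradient u x‖ ^ 2 := by
        rw [← rpow_natCast, ← rpow_add hn]
        congr 1
        push_cast
        ring
      have hCS : ⟪gradient u x, gradient φ x⟫ ^ 2 ≤ (‖gradient u x‖ * ‖gradient φ x‖) ^ 2 := by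
        rw [← sq_abs]
        gcongr
        exact abs_real_inner_le_norm _ _
      simp only [e, mul_assoc, ← mul_pow]
      gcongr
  have h := hst φ (lipCS_of_contDiff hφ hφc)
  have := mul_le_mul_of_nonneg_left hle (show 0 ≤ p - 2 by linarith)
  linarith

lemma IsStable.potDensity_le (hp : 2 ≤ p) (hσ : 1 ≤ σ) (hγ : 1 < γ) (hj : p < 2 * j + 2)
    (hs : 0 < s) (hs1 : s ≤ 1) (hu : ContDiff ℝ 1 u) (hst : IsStable p σ V u)
    (hψ : ContDiff ℝ 1 ψ) (hψc : HasCompactSupport ψ) (hψ0 : ∀ x, 0 ≤ ψ x) :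
    σ * ∫ x, potDensity σ γ j V u ψ x ≤ (p - 1) * ((γ + 1) ^ 2 / 4 *
      (∫ x, gradDensity p γ j u ψ x) + ((γ + 1) * (2 * j + 2) / 2 + (2 * j + 2) ^ 2 / 4) *
        (s * (∫ x, gradDensity p γ j u ψ x) +
          s ^ (1 - p) * ∫ x, cutoffDensity p γ j u ψ x)) := by
  have ha : 0 < (γ - 1) / 2 := by linarith
  have hφ := contDiff_testFun ha j hu hψ
  have hφc := hasCompactSupport_testFun ((γ - 1) / 2) j u hψc
  have hsq : ∀ x, |u x| ^ (γ - 1) = (|u x| ^ ((γ - 1) / 2)) ^ 2 := fun x => by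
    rw [← rpow_natCast, ← rpow_mul (abs_nonneg _)]
    congr 1
    push_cast
    ring
  have hlhs : (∫ x, V x * |u x| ^ (σ - 1) * testFun ((γ - 1) / 2) j u ψ x ^ 2) =
      ∫ x, potDensity σ γ j V u ψ x := by
    refine integral_congr_ae (Eventually.of_forall fun x => ?_)
    simp only [testFun, potDensity, abs_rpow_add_mul_sq hσ hγ, hsq]
    ring
  have h := hst.le_integral hp hu hφ hφc
  rw [hlhs] at h
  refine h.trans (mul_le_mul_of_nonneg_left ?_ (by linarith))
  have hle : ∫ x, ‖gradient u x‖ ^ (p - 2) * ‖gradient (testFun ((γ - 1) / 2) j u ψ) x‖ ^ 2 ≤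
      ∫ x, (((γ + 1) ^ 2 / 4 + ((γ + 1) * (2 * j + 2) / 2 + (2 * j + 2) ^ 2 / 4) * s) *
        gradDensity p γ j u ψ x + (((γ + 1) * (2 * j + 2) / 2 + (2 * j + 2) ^ 2 / 4) *
          s ^ (1 - p)) * cutoffDensity p γ j u ψ x) := by
    refine integral_mono_of_nonneg (Eventually.of_forall fun x => by positivity)
      (integrable_gradDensity_add_cutoffDensity hp hγ hj hu hψ hψc _ _)
      (Eventually.of_forall fun x => ?_)
    have hψx := hψ0 x
    obtain ⟨hY1, hY2⟩ := weighted_interpolate_le hp hj.le hs hs1 (norm_nonneg (gradient u x))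
      (abs_nonneg (u x)) (norm_nonneg (gradient ψ x)) hψx
      (rpow_nonneg (abs_nonneg (u x)) (γ - 1))
    have hnorm : ‖gradient (testFun ((γ - 1) / 2) j u ψ) x‖ ≤
        (γ + 1) / 2 * |u x| ^ ((γ - 1) / 2) * ψ x ^ (j + 1) * ‖gradient u x‖ +
          (j + 1) * |u x| ^ ((γ - 1) / 2) * |u x| * ψ x ^ j * ‖gradient ψ x‖ := by
      rw [gradient_testFun ha j hu hψ]
      refine (norm_add_le _ _).trans (le_of_eq ?_)
      rw [norm_smul, norm_smul]
      simp only [norm_mul, norm_pow, Real.norm_eq_abs, abs_of_nonneg hψx,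
        abs_of_nonneg (rpow_nonneg (abs_nonneg (u x)) ((γ - 1) / 2)),
        abs_of_nonneg (show 0 ≤ (γ - 1) / 2 + 1 by linarith),
        abs_of_nonneg (show (0 : ℝ) ≤ j + 1 by positivity)]
      ring
    have hmain := mul_le_mul_of_nonneg_left (pow_le_pow_left₀ (norm_nonneg _) hnorm 2)
      (rpow_nonneg (norm_nonneg (gradient u x)) (p - 2))
    have h1 := mul_le_mul_of_nonneg_left hY1
      (show (0 : ℝ) ≤ (γ + 1) * (2 * j + 2) / 2 by positivity)
    have h2 := mul_le_mul_of_nonneg_left hY2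
      (show (0 : ℝ) ≤ (2 * j + 2) ^ 2 / 4 by positivity)
    simp only [gradDensity, cutoffDensity]
    simp only [hsq] at h1 h2 ⊢
    linear_combination hmain + h1 + h2
  rw [integral_gradDensity_add_cutoffDensity hp hγ hj hu hψ hψc] at hle
  linarith

lemma cutoffDensity_le {e τ η : ℝ} (hp : 2 ≤ p) (hτ : 0 < τ) (he : 0 ≤ e)
    (hj : p * (1 + e) ≤ 2 * j + 2) (hp2 : p < 2 * j + 2) (hη : 0 < η)
    (hγe : γ = τ * e - (p - 1)) (hγ : 1 < γ) (hτσ : σ = τ + (p - 1))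
    (hVloc : LocallyIntegrable V) (hVpos : ∀ᵐ x : Em m, 0 < V x) (hu : ContDiff ℝ 1 u)
    (hψ : ContDiff ℝ 1 ψ) (hψc : HasCompactSupport ψ) (hψ0 : ∀ x, 0 ≤ ψ x) (hψ1 : ∀ x, ψ x ≤ 1)
    {W : Em m → ℝ} (hW : Integrable W)
    (hVW : ∀ᵐ x, V x ^ (-e) * ‖gradient ψ x‖ ^ (p * (1 + e)) ≤ W x) :
    ∫ x, cutoffDensity p γ j u ψ x ≤
      η * (∫ x, potDensity σ γ j V u ψ x) + η ^ (-e) * ∫ x, W x := by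
  have hB := integrable_potDensity (j := j) (σ := σ) (γ := γ) (by linarith) hVloc hu.continuous
    hψ.continuous hψc
  rw [← integral_const_mul, ← integral_const_mul,
    ← integral_add (hB.const_mul _) (hW.const_mul _)]
  refine integral_mono_ae (integrable_cutoffDensity hp hγ hp2 hu hψ hψc)
    ((hB.const_mul _).add (hW.const_mul _)) ?_
  filter_upwards [hVpos, hVW] with x hVx hWx
  have h := absorb_le hp hτ he hj hη hVx (abs_nonneg (u x)) (norm_nonneg (gradient ψ x))
    (hψ0 x) (hψ1 x)
  have e1 : |u x| ^ (τ * e) = |u x| ^ (γ - 1) * |u x| ^ p := by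
    rw [← rpow_add_of_nonneg (abs_nonneg _) (by linarith) (by linarith), hγe]
    congr 1
    ring
  have e2 : σ + γ = τ + τ * e := by rw [hγe, hτσ]; ring
  simp only [cutoffDensity, potDensity, e2]
  rw [e1] at h
  have hW' := mul_le_mul_of_nonneg_left hWx (rpow_nonneg hη.le (-e))
  linear_combination h + hW'

end

lemma exists_integral_potDensity_le {m : ℕ} {p σ : ℝ} (hp : 2 ≤ p) (hσ : p - 1 < σ)
    {V u : Em m → ℝ} (hVloc : LocallyIntegrable V) (hVpos : ∀ᵐ x : Em m, 0 < V x)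
    (hu : IsWeakSol p σ V u) (hst : IsStable p σ V u) :
    ∃ j : ℕ, ∃ ε₁ > 0, ∃ c > 0, ∀ ε ∈ Ioo (0 : ℝ) ε₁,
      1 < gammaBar p σ - ε * (σ - p + 1) ∧
      ∀ ψ : Em m → ℝ, ContDiff ℝ 1 ψ → HasCompactSupport ψ → (∀ x, 0 ≤ ψ x) → (∀ x, ψ x ≤ 1) →
        ∀ W : Em m → ℝ, Integrable W →
          (∀ᵐ x, V x ^ (-betaC p σ + ε) * ‖gradient ψ x‖ ^ (p * (1 + (betaC p σ - ε))) ≤ W x) →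
          ∫ x, potDensity σ (gammaBar p σ - ε * (σ - p + 1)) j V u ψ x ≤
            (c * ε ^ p) ^ (-(1 + betaC p σ)) * ∫ x, W x := by
  have hβ := betaC_pos hp hσ
  obtain ⟨j, hj⟩ := exists_nat_ge (p * (1 + betaC p σ))
  have hj' : p * (1 + betaC p σ) ≤ 2 * j + 2 := by
    have : (0 : ℝ) ≤ j := Nat.cast_nonneg j
    linarith
  have hj2 : p < 2 * j + 2 := by nlinarith
  obtain ⟨ε₁, hε₁, c, hc, H⟩ :=
    exists_absorption_constant (k := 2 * j + 2) hp hσ (by positivity)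
  refine ⟨j, ε₁, hε₁, c, hc, fun ε hε => ?_⟩
  obtain ⟨hγ, hεβ, H⟩ := H ε hε
  refine ⟨hγ, fun ψ hψ hψc hψ0 hψ1 W hW hVW => ?_⟩
  have hσ1 : 1 ≤ σ := by linarith
  have hVW' : ∀ᵐ x, V x ^ (-(betaC p σ - ε)) *
      ‖gradient ψ x‖ ^ (p * (1 + (betaC p σ - ε))) ≤ W x := by
    rwa [show -(betaC p σ - ε) = -betaC p σ + ε by ring]
  refine H _ (∫ x, gradDensity p (gammaBar p σ - ε * (σ - p + 1)) j u ψ x) _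
    (∫ x, cutoffDensity p (gammaBar p σ - ε * (σ - p + 1)) j u ψ x) _ rfl ?_ ?_ ?_ ?_ ?_ ?_ ?_
  · refine integral_nonneg fun x => ?_
    have := hψ0 x
    simp only [gradDensity, Pi.zero_apply]
    positivity
  · refine integral_nonneg_of_ae ?_
    filter_upwards [hVpos] with x hx
    have := hψ0 x
    simp only [potDensity, Pi.zero_apply]
    positivity
  · refine integral_nonneg fun x => ?_
    have := hψ0 x
    simp only [cutoffDensity, Pi.zero_apply]
    positivity
  · refine integral_nonneg_of_ae ?_
    filter_upwards [hVpos, hVW] with x hx hWx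
    refine le_trans ?_ hWx
    simp only [Pi.zero_apply]
    positivity
  · exact fun s hs => hu.gradDensity_le hp hσ1 hγ hj2 hs.1 hs.2 hψ hψc hψ0
  · exact fun s hs => hst.potDensity_le hp hσ1 hγ hj2 hs.1 hs.2 hu.1 hψ hψc hψ0
  · intro η hη
    refine cutoffDensity_le hp (τ := σ - p + 1) (by linarith) (by linarith) ?_ hj2 hη
      (gammaBar_sub_eq hσ ε) hγ (by ring) hVloc hVpos hu.1 hψ hψc hψ0 hψ1 hW hVW'
    refine le_trans ?_ hj'
    have := hε.1
    gcongr
    linarith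

/-! ### Cutoff functions -/

lemma exists_cutoff (m : ℕ) :
    ∃ M : ℝ, 1 ≤ M ∧ ∀ R > 0, ∃ ψ : Em m → ℝ, ContDiff ℝ 1 ψ ∧ HasCompactSupport ψ ∧
      (∀ x, 0 ≤ ψ x) ∧ (∀ x, ψ x ≤ 1) ∧ (∀ x ∈ ball (0 : Em m) (R / 2), ψ x = 1) ∧
      (∀ x, ‖gradient ψ x‖ ≤ M / R) ∧
      ∀ x ∉ ball (0 : Em m) R \ ball (0 : Em m) (R / 2), gradient ψ x = 0 := by
  let f : ContDiffBump (0 : Em m) := ⟨1 / 2, 1, by norm_num, by norm_num⟩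
  have hf : ContDiff ℝ 1 f := f.contDiff
  obtain ⟨K, hK⟩ := hf.lipschitzWith_of_hasCompactSupport f.hasCompactSupport one_ne_zero
  refine ⟨max 1 K, le_max_left _ _, fun R hR => ?_⟩
  have hR' : R⁻¹ ≠ 0 := inv_ne_zero hR.ne'
  have hnorm : ∀ x : Em m, ‖R⁻¹ • x‖ = ‖x‖ / R := fun x => by
    rw [norm_smul, norm_inv, Real.norm_of_nonneg hR.le, inv_mul_eq_div]
  have hone : ∀ x ∈ ball (0 : Em m) (R / 2), f (R⁻¹ • x) = 1 := by
    intro x hx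
    refine f.one_of_mem_closedBall ?_
    rw [mem_ball_zero_iff] at hx
    rw [mem_closedBall_zero_iff, hnorm, div_le_iff₀ hR]
    change ‖x‖ ≤ 1 / 2 * R
    linarith
  have hLip : LipschitzWith (K * ‖R⁻¹‖₊) fun x : Em m => f (R⁻¹ • x) :=
    hK.comp (lipschitzWith_smul R⁻¹)
  refine ⟨fun x => f (R⁻¹ • x), hf.comp (contDiff_const_smul _),
    f.hasCompactSupport.comp_homeomorph (Homeomorph.smulOfNeZero _ hR'), fun x => f.nonneg,
    fun x => f.le_one, hone, fun x => ?_, fun x hx => ?_⟩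
  · have : ‖gradient (fun x : Em m => f (R⁻¹ • x)) x‖ = ‖fderiv ℝ (fun x : Em m => f (R⁻¹ • x)) x‖ :=
      LinearIsometryEquiv.norm_map _ _
    rw [this]
    refine (norm_fderiv_le_of_lipschitz ℝ hLip).trans ?_
    rw [NNReal.coe_mul, coe_nnnorm, norm_inv, Real.norm_of_nonneg hR.le, ← div_eq_mul_inv]
    gcongr
    exact le_max_right _ _
  · have hfd : fderiv ℝ (fun x : Em m => f (R⁻¹ • x)) x = 0 := by
      by_cases hx2 : x ∈ ball (0 : Em m) (R / 2)
      · have : (fun x : Em m => f (R⁻¹ • x)) =ᶠ[nhds x] fun _ => 1 :=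
          mem_of_superset (isOpen_ball.mem_nhds hx2) hone
        rw [this.fderiv_eq]
        simp
      · have hxR : R ≤ ‖x‖ := by
          by_contra! h
          exact hx ⟨mem_ball_zero_iff.2 h, hx2⟩
        have h0 : f (R⁻¹ • x) = 0 := by
          refine f.zero_of_le_dist ?_
          rw [dist_zero_right, hnorm]
          exact (one_le_div hR).2 hxR
        refine IsLocalMin.fderiv_eq_zero (Eventually.of_forall fun y => ?_)
        simp only [h0]
        exact f.nonneg
    rw [gradient, hfd, map_zero]

/-! ### Growth of the right-hand side -/

lemma growth_bound {p N c M C C₀ θ b κ R : ℝ} (hp : 0 ≤ p) (hN : 0 ≤ N) (hc : 0 < c)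
    (hM : 1 ≤ M) (hC : 0 < C) (hθ : 0 < θ) (hκ : 0 < κ)
    (hκθ : θ * κ / 2 = p * N + |b| + 1) (hR : 0 < R) (hL : 2 ≤ log R) :
    (c * (κ / log R) ^ p) ^ (-N) * ((M / R) ^ (p * (N - κ / log R)) *
      (C * R ^ (p * N + C₀ * (κ / log R)) * log R ^ b *
        exp (-θ * (κ / log R) * log (R / 2) * log (log (R / 2))))) ≤
    c ^ (-N) * κ ^ (-(p * N)) * M ^ (p * N) * exp ((p + C₀) * κ) * C * 2 ^ (θ * κ / 2) *
      (log R)⁻¹ := by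
  set L := log R with hLdef
  have hL0 : 0 < L := by linarith
  have hM0 : 0 < M := by linarith
  have hpN : 0 ≤ p * N := mul_nonneg hp hN
  have e1 : (c * (κ / L) ^ p) ^ (-N) = c ^ (-N) * κ ^ (-(p * N)) * L ^ (p * N) := by
    rw [mul_rpow hc.le (by positivity), ← rpow_mul (by positivity), div_rpow hκ.le hL0.le,
      mul_neg, rpow_neg hL0.le (p * N)]
    field_simp
  have e2 : (M / R) ^ (p * (N - κ / L)) * R ^ (p * N + C₀ * (κ / L)) =
      M ^ (p * (N - κ / L)) * exp ((p + C₀) * κ) := by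
    rw [div_rpow hM0.le hR.le, div_mul_eq_mul_div, mul_div_assoc, ← rpow_sub hR, rpow_def_of_pos hR,
      ← hLdef]
    congr 2
    field_simp
    ring
  have e3 : M ^ (p * (N - κ / L)) ≤ M ^ (p * N) := by
    refine rpow_le_rpow_of_exponent_le hM (mul_le_mul_of_nonneg_left ?_ hp)
    have : 0 < κ / L := by positivity
    linarith
  have hlog : log (R / 2) = L - log 2 := by rw [log_div hR.ne' two_ne_zero]
  have hl2 := log_two_lt_d9
  have h1 : L / 2 ≤ log (R / 2) := by rw [hlog]; linarith
  have h2 : log (L / 2) ≤ log (log (R / 2)) := log_le_log (by positivity) h1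
  have h3 : 0 ≤ log (L / 2) := log_nonneg (by linarith)
  have e4 : exp (-θ * (κ / L) * log (R / 2) * log (log (R / 2))) ≤
      2 ^ (θ * κ / 2) * L ^ (-(θ * κ / 2)) := by
    have a1 : 2 ^ (θ * κ / 2) * L ^ (-(θ * κ / 2)) = exp (-(θ * κ / 2) * log (L / 2)) := by
      rw [rpow_def_of_pos two_pos, rpow_def_of_pos hL0, ← Real.exp_add,
        log_div hL0.ne' two_ne_zero]
      ring_nf
    rw [a1, Real.exp_le_exp]
    have a2 : θ * (κ / L) * (L / 2 * log (L / 2)) ≤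
        θ * (κ / L) * (log (R / 2) * log (log (R / 2))) := by
      have h4 : 0 ≤ log (R / 2) := by linarith
      gcongr
    have a3 : θ * (κ / L) * (L / 2 * log (L / 2)) = θ * κ / 2 * log (L / 2) := by
      field_simp
    linarith
  have e5 : L ^ (p * N) * L ^ b * L ^ (-(θ * κ / 2)) ≤ L⁻¹ := by
    rw [← rpow_add hL0, ← rpow_add hL0, ← rpow_neg_one, hκθ]
    refine rpow_le_rpow_of_exponent_le (by linarith) ?_
    linarith [le_abs_self b]
  calc (c * (κ / L) ^ p) ^ (-N) * ((M / R) ^ (p * (N - κ / L)) *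
      (C * R ^ (p * N + C₀ * (κ / L)) * L ^ b *
        exp (-θ * (κ / L) * log (R / 2) * log (log (R / 2)))))
      = (c ^ (-N) * κ ^ (-(p * N)) * L ^ (p * N)) * (((M / R) ^ (p * (N - κ / L)) *
          R ^ (p * N + C₀ * (κ / L))) * C * L ^ b *
            exp (-θ * (κ / L) * log (R / 2) * log (log (R / 2)))) := by rw [e1]; ring
    _ ≤ (c ^ (-N) * κ ^ (-(p * N)) * L ^ (p * N)) * ((M ^ (p * N) * exp ((p + C₀) * κ)) * C * L ^ b *
            (2 ^ (θ * κ / 2) * L ^ (-(θ * κ / 2)))) := by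
        rw [e2]
        gcongr
    _ = c ^ (-N) * κ ^ (-(p * N)) * M ^ (p * N) * exp ((p + C₀) * κ) * C * 2 ^ (θ * κ / 2) *
          (L ^ (p * N) * L ^ b * L ^ (-(θ * κ / 2))) := by ring
    _ ≤ _ := by gcongr

lemma integral_indicator_le {m : ℕ} {S : Set (Em m)} (hS : MeasurableSet S) {f : Em m → ℝ}
    (hf : AEMeasurable f) (hf0 : ∀ᵐ x, 0 ≤ f x) {B q : ℝ} (hB : 0 ≤ B) (hq : 0 ≤ q)
    (h : ∫⁻ x in S, ENNReal.ofReal (f x) ≤ ENNReal.ofReal B) :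
    Integrable (S.indicator fun x => q * f x) ∧
      ∫ x, S.indicator (fun x => q * f x) x ≤ q * B := by
  have hint : IntegrableOn f S := by
    refine ⟨hf.aestronglyMeasurable.restrict, ?_⟩
    rw [hasFiniteIntegral_iff_ofReal (ae_restrict_of_ae hf0)]
    exact h.trans_lt ENNReal.ofReal_lt_top
  refine ⟨IntegrableOn.integrable_indicator (hint.const_mul q) hS, ?_⟩
  rw [integral_indicator hS, integral_const_mul]
  refine mul_le_mul_of_nonneg_left ?_ hq
  rw [integral_eq_lintegral_of_nonneg_ae (ae_restrict_of_ae hf0)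
    hf.aestronglyMeasurable.restrict]
  exact ENNReal.toReal_le_of_le_ofReal hB h

lemma min_abs_rpow_le {σ γ G t : ℝ} (hσ : 0 ≤ σ) (h1 : 1 ≤ γ) (hG : γ ≤ G) :
    min (|t| ^ (σ + 1)) (|t| ^ (σ + G)) ≤ |t| ^ (σ + γ) := by
  rcases le_total |t| 1 with h | h
  · exact (min_le_right _ _).trans
      (rpow_le_rpow_of_exponent_ge' (abs_nonneg t) h (by linarith) (by linarith))
  · exact (min_le_left _ _).trans (rpow_le_rpow_of_exponent_le h (by linarith))

/-! ### Main theorem -/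

theorem nonexistence_stable_HP2 (m : ℕ) (hm : 1 ≤ m) (p σ : ℝ) (hp : 2 ≤ p) (hσ : p - 1 < σ)
    (V : Em m → ℝ) (hVloc : LocallyIntegrable V volume)
    (hVpos : ∀ᵐ x : Em m, 0 < V x)
    (hHP2 : HP2 p σ V)
    (u : Em m → ℝ) (hu : IsWeakSol p σ V u) (hst : IsStable p σ V u) :
    ∀ᵐ x : Em m, u x = 0 := by
  have hβ := betaC_pos hp hσ
  have hγ1 := one_lt_gammaBar hp hσ
  have hu1 := hu.1.continuous
  have hσ0 : 0 < σ := by linarith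
  obtain ⟨C, C₀, R₀, ε₀, θ, b, hC, hC₀, hR₀, hε₀, hθ, -, hHP⟩ := hHP2
  obtain ⟨j, ε₁, hε₁, c, hc, H⟩ := exists_integral_potDensity_le hp hσ hVloc hVpos hu hst
  obtain ⟨M, hM, hcut⟩ := exists_cutoff m
  set G := gammaBar p σ
  set β := betaC p σ
  set κ := 2 * (p * (1 + β) + |b| + 1) / θ with hκdef
  have hκ : 0 < κ := by positivity
  have hκθ : θ * κ / 2 = p * (1 + β) + |b| + 1 := by rw [hκdef]; field_simp
  set K := c ^ (-(1 + β)) * κ ^ (-(p * (1 + β))) * M ^ (p * (1 + β)) * exp ((p + C₀) * κ) * C *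
    2 ^ (θ * κ / 2)
  set h : Em m → ℝ := fun x => V x * min (|u x| ^ (σ + 1)) (|u x| ^ (σ + G)) with hh
  have hh0 : ∀ᵐ x, 0 ≤ h x := by
    filter_upwards [hVpos] with x hx
    positivity
  have hmin : Continuous fun x => min (|u x| ^ (σ + 1)) (|u x| ^ (σ + G)) :=
    (hu1.abs.rpow_const fun _ => Or.inr (by linarith)).min
      (hu1.abs.rpow_const fun _ => Or.inr (by linarith))
  have hεlim : Tendsto (fun R => κ / log R) atTop (nhds 0) := tendsto_log_atTop.const_div_atTop κ
  have hball : ∀ r : ℝ, ∀ᵐ x ∂volume.restrict (ball (0 : Em m) r), h x = 0 := by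
    intro r
    have hint : IntegrableOn h (ball 0 r) :=
      ((hVloc.integrableOn_isCompact (isCompact_closedBall 0 r)).mul_continuousOn
        hmin.continuousOn (isCompact_closedBall 0 r)).mono_set ball_subset_closedBall
    have hev : ∀ᶠ R in atTop, ∫ x in ball (0 : Em m) r, h x ≤ K * (log R)⁻¹ := by
      filter_upwards [eventually_gt_atTop 0, eventually_gt_atTop R₀, eventually_ge_atTop (2 * r),
        tendsto_log_atTop.eventually_ge_atTop 2, hεlim.eventually_lt_const hε₀,
        hεlim.eventually_lt_const hε₁] with R hR hRR₀ hRr hL hεε₀ hεε₁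
      have hε : 0 < κ / log R := by positivity
      obtain ⟨ψ, hψ, hψc, hψ0, hψ1, hψone, hψM, hψz⟩ := hcut R hR
      obtain ⟨hγ, H⟩ := H _ ⟨hε, hεε₁⟩
      have hB : 0 ≤ C * R ^ (alphaC p σ + C₀ * (κ / log R)) * log R ^ b *
          exp (-θ * (κ / log R) * log (R / 2) * log (log (R / 2))) := by positivity
      obtain ⟨hWint, hWle⟩ := integral_indicator_le
        (measurableSet_ball.diff measurableSet_ball)
        (hVloc.aestronglyMeasurable.aemeasurable.pow_const (-β + κ / log R))
        (hVpos.mono fun x hx => rpow_nonneg hx.le _) hB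
        (q := (M / R) ^ (p * (1 + (β - κ / log R)))) (by positivity)
        (hHP _ ⟨hε, hεε₀⟩ R hRR₀)
      have hexp : 0 < p * (1 + (β - κ / log R)) := by
        have e := gammaBar_sub_eq hσ (κ / log R)
        have : 0 < (σ - p + 1) * (β - κ / log R) := by linarith
        have := pos_of_mul_pos_right this (by linarith)
        positivity
      have hP := H ψ hψ hψc hψ0 hψ1 _ hWint (by
        filter_upwards [hVpos] with x hx
        by_cases hxS : x ∈ ball (0 : Em m) R \ ball (0 : Em m) (R / 2)
        · rw [indicator_of_mem hxS, mul_comm]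
          gcongr
          exact hψM x
        · rw [indicator_of_notMem hxS, hψz x hxS, norm_zero, zero_rpow hexp.ne', mul_zero])
      have hP' : ∫ x, potDensity σ (G - κ / log R * (σ - p + 1)) j V u ψ x ≤ K * (log R)⁻¹ := by
        refine hP.trans ((mul_le_mul_of_nonneg_left hWle (by positivity)).trans ?_)
        rw [alphaC_eq hσ, ← add_sub_assoc]
        exact growth_bound (by linarith) (by linarith) hc hM hC hθ hκ hκθ hR hL
      refine le_trans ?_ hP'
      have hpi := integrable_potDensity (j := j) (σ := σ) (γ := G - κ / log R * (σ - p + 1))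
        (by linarith) hVloc hu1 hψ.continuous hψc
      have hp0 : ∀ᵐ x, 0 ≤ potDensity σ (G - κ / log R * (σ - p + 1)) j V u ψ x := by
        filter_upwards [hVpos] with x hx
        have := hψ0 x
        simp only [potDensity]
        positivity
      refine le_trans ?_ (setIntegral_le_integral (s := ball (0 : Em m) r) hpi hp0)
      refine setIntegral_mono_ae_restrict hint hpi.integrableOn ?_
      filter_upwards [ae_restrict_of_ae hVpos, ae_restrict_mem measurableSet_ball] with x hx hxr
      have hx1 : ψ x = 1 := hψone x (ball_subset_ball (by linarith) hxr)
      simp only [hh, potDensity, hx1, one_pow, mul_one]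
      refine mul_le_mul_of_nonneg_left (min_abs_rpow_le hσ0.le hγ.le ?_) hx.le
      have : 0 ≤ κ / log R * (σ - p + 1) := mul_nonneg hε.le (by linarith)
      linarith
    have hle : ∫ x in ball (0 : Em m) r, h x ≤ 0 := by
      refine ge_of_tendsto ?_ hev
      simpa using (tendsto_inv_atTop_zero.comp tendsto_log_atTop).const_mul K
    have hz := le_antisymm hle (integral_nonneg_of_ae (ae_restrict_of_ae hh0))
    exact (integral_eq_zero_iff_of_nonneg_ae (ae_restrict_of_ae hh0) hint).1 hz
  have hall : ∀ᵐ x, ∀ n : ℕ, x ∈ ball (0 : Em m) n → h x = 0 :=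
    ae_all_iff.2 fun n => (ae_restrict_iff' measurableSet_ball).1 (hball n)
  filter_upwards [hall, hVpos] with x hx hVx
  obtain ⟨n, hn⟩ := exists_nat_gt ‖x‖
  have hx0 := hx n (mem_ball_zero_iff.2 hn)
  by_contra hux
  have : 0 < |u x| := abs_pos.2 hux
  have : 0 < h x := by positivity
  exact this.ne' hx0
end
end

section
/- Let V ≡ 1 and assume either m ≤ p(p+3)/(p−1), or m > p(p+3)/(p−1) together with σ < σ_c(m, p), where σ_c(m, p) = [((p−1)m − p)² + p²(p−2) − p²(p−1)m + 2p²√((p−1)(m−1))] / ((m−p)((p−1)m − p(p+3))). Then every stable weak solution u of −Δ_p u = |u|^{σ−1}u on ℝ^m vanishes identically, i.e. u = 0 almost everywhere on ℝ^m. -/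
open MeasureTheory Real Set Metric Filter
open scoped ENNReal NNReal RealInnerProductSpace

noncomputable section

/-- Along the range of admissible exponents, `m` lies strictly below `α`. -/
theorem lt_alphaC {p σ μ : ℝ} (hp : 2 ≤ p) (hσ : p - 1 < σ)
    (hcrit : μ ≤ p * (p + 3) / (p - 1) ∨ (μ > p * (p + 3) / (p - 1) ∧ σ < sigmaC μ p)) :
    μ < alphaC p σ := by
  have hq : 0 < p - 1 := by linarith
  have hτ : 0 < σ - p + 1 := by linarith
  have hσ0 : 0 < σ := by linarith
  set s := √(σ * (σ - p + 1)) with hs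
  have hs0 : 0 ≤ s := Real.sqrt_nonneg _
  have hs2 : s ^ 2 = σ * (σ - p + 1) := Real.sq_sqrt (by positivity)
  have hα : alphaC p σ =
      p * (σ * (p + 1) - (p - 1) + 2 * s) / ((p - 1) * (σ - p + 1)) := by
    unfold alphaC gammaBar
    rw [← hs]
    field_simp
    ring
  rw [hα]
  rcases hcrit with h | ⟨h, hσc⟩
  · refine h.trans_lt ?_
    have hsτ : σ - p + 1 < s := by
      refine lt_of_pow_lt_pow_left₀ 2 hs0 ?_
      rw [hs2]
      nlinarith
    rw [div_lt_div_iff₀ hq (by positivity)]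
    have key : (p + 3) * (σ - p + 1) < σ * (p + 1) - (p - 1) + 2 * s := by nlinarith
    have hpq : 0 < p * (p - 1) := by positivity
    nlinarith [mul_lt_mul_of_pos_left key hpq]
  · by_contra! hcon
    have hX : p * (p + 3) < μ * (p - 1) := (div_lt_iff₀ hq).1 h
    have hμp : 0 < μ - p := by
      have : 0 < (p - 1) * (μ - p) := by nlinarith
      exact pos_of_mul_pos_right this hq.le
    have hden : 0 < (μ - p) * ((p - 1) * μ - p * (p + 3)) :=
      mul_pos hμp (by linarith)
    set S := √((p - 1) * (μ - 1)) with hS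
    have hS0 : 0 ≤ S := Real.sqrt_nonneg _
    have hS2 : S ^ 2 = (p - 1) * (μ - 1) :=
      Real.sq_sqrt (mul_nonneg hq.le (by linarith))
    rw [div_le_iff₀ (by positivity)] at hcon
    set L := σ * (μ * (p - 1) - p * (p + 1)) - (p - 1) * (μ * (p - 1) - p) with hL
    have hLs : 2 * p * s ≤ L := by rw [hL]; linarith
    have hps : 0 ≤ 2 * p * s := by positivity
    have hL0 : 0 ≤ L := hps.trans hLs
    have hL2 : 4 * p ^ 2 * (σ * (σ - p + 1)) ≤ L ^ 2 := by
      rw [← hs2]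
      linarith only [pow_le_pow_left₀ hps hLs 2]
    unfold sigmaC at hσc
    rw [← hS, lt_div_iff₀ hden] at hσc
    set d := (μ - p) * ((p - 1) * μ - p * (p + 3)) with hd
    set c := ((p - 1) * μ - p) ^ 2 + p ^ 2 * (p - 2) - p ^ 2 * (p - 1) * μ with hc
    have hquad : (2 * p ^ 2 * S) ^ 2 ≤ (d * σ - c) ^ 2 := by
      have hid : (p - 1) * ((d * σ - c) ^ 2 - (2 * p ^ 2 * S) ^ 2) =
          d * (L ^ 2 - 4 * p ^ 2 * (σ * (σ - p + 1))) := by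
        rw [mul_pow _ S, hS2, hd, hc, hL]
        ring
      have : 0 ≤ (p - 1) * ((d * σ - c) ^ 2 - (2 * p ^ 2 * S) ^ 2) := by
        rw [hid]
        exact mul_nonneg hden.le (by linarith)
      linarith [nonneg_of_mul_nonneg_right this hq]
    have hlow : d * σ - c ≤ -(2 * p ^ 2 * S) := by
      by_contra! hlt
      have h1 : 0 < d * σ - c + 2 * p ^ 2 * S := by linarith
      have h2 : 0 < 2 * p ^ 2 * S - (d * σ - c) := by linarith
      have h3 := mul_pos h1 h2
      linarith only [h3, hquad]
    have hSp : p + 1 < S := by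
      refine lt_of_pow_lt_pow_left₀ 2 hS0 ?_
      rw [hS2]
      linarith only [hX]
    set X := μ * (p - 1) - p * (p + 1) with hXdef
    have hX0 : 0 < X := by rw [hXdef]; linarith only [hX, hp]
    have hdX : d * (p - 1) = X ^ 2 - 4 * p ^ 2 := by rw [hd, hXdef]; ring
    have hXS : X = S ^ 2 - 1 - p ^ 2 := by rw [hS2, hXdef]; ring
    have hcS : c = X * (S ^ 2 - 1) - 2 * p ^ 2 := by
      rw [hS2, hc, hXdef]; ring
    have hLS : (p - 1) * (S ^ 2 - 1) ≤ σ * X := by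
      have : L = σ * X - (p - 1) * (S ^ 2 - 1) := by rw [hL, hS2]; ring
      linarith
    have h1 : d * ((p - 1) * (S ^ 2 - 1)) ≤ d * (σ * X) :=
      mul_le_mul_of_nonneg_left hLS hden.le
    have h2 : d * (σ * X) ≤ (c - 2 * p ^ 2 * S) * X := by
      have := mul_le_mul_of_nonneg_right (sub_le_iff_le_add'.1 hlow) hX0.le
      linarith only [this]
    have h3 : (X ^ 2 - 4 * p ^ 2) * (S ^ 2 - 1) ≤ (c - 2 * p ^ 2 * S) * X := by
      rw [← hdX]; linarith
    have h4 : p ^ 2 * ((S + 1) * X) ≤ p ^ 2 * (2 * (S ^ 2 - 1)) := by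
      rw [hcS] at h3
      linarith only [h3]
    have h5 : (S + 1) * X ≤ 2 * (S ^ 2 - 1) := le_of_mul_le_mul_left h4 (by positivity)
    have h6 : (S + 1) * X ≤ (S + 1) * (2 * (S - 1)) := by linarith
    have h7 : X ≤ 2 * (S - 1) := le_of_mul_le_mul_left h6 (by linarith)
    have h8 : 0 < (S - 1 - p) * (S - 1 + p) := mul_pos (by linarith) (by linarith)
    linarith only [h7, h8, hXS]

/-- Below the threshold `γ̄` there is an exponent, larger than `1`, for which the stability
inequality beats the energy identity and the decay rate exceeds the dimension. -/
theorem exists_exponent {p σ μ : ℝ} (hp : 2 ≤ p) (hσ : p - 1 < σ) (hμ : μ < alphaC p σ) :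
    ∃ γ : ℝ, 1 < γ ∧ (p - 1) * ((γ + 1) / 2) ^ 2 < σ * γ ∧
      μ < p * (σ + γ) / (σ - p + 1) := by
  have hq : 0 < p - 1 := by linarith
  have hτ : 0 < σ - p + 1 := by linarith
  have hσ0 : 0 < σ := by linarith
  set s := √(σ * (σ - p + 1)) with hs
  have hs0 : 0 ≤ s := Real.sqrt_nonneg _
  have hs2 : s ^ 2 = σ * (σ - p + 1) := Real.sq_sqrt (by positivity)
  have hsτ : σ - p + 1 < s := by
    refine lt_of_pow_lt_pow_left₀ 2 hs0 ?_
    rw [hs2]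
    nlinarith
  have h1 : 1 < gammaBar p σ := by
    unfold gammaBar
    rw [lt_div_iff₀ hq]
    linarith
  have h2 : μ * (σ - p + 1) / p - σ < gammaBar p σ := by
    unfold alphaC at hμ
    rw [lt_div_iff₀ hτ] at hμ
    rw [sub_lt_iff_lt_add', div_lt_iff₀ (by linarith)]
    linarith
  obtain ⟨γ, hγ, hγ'⟩ := exists_between (max_lt h1 h2)
  obtain ⟨hγ1, hγ2⟩ := max_lt_iff.1 hγ
  refine ⟨γ, hγ1, ?_, ?_⟩
  · unfold gammaBar at hγ'
    rw [lt_div_iff₀ hq, ← hs] at hγ'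
    have ha : 0 < 2 * s - (γ * (p - 1) - (2 * σ - p + 1)) := by linarith
    have hb : 0 < 2 * s + (γ * (p - 1) - (2 * σ - p + 1)) := by nlinarith
    have hab := mul_pos ha hb
    have : 0 < (p - 1) * (4 * (σ * γ) - (p - 1) * (γ + 1) ^ 2) := by nlinarith
    have := pos_of_mul_pos_right this hq.le
    linarith
  · rw [lt_div_iff₀ hτ]
    rw [sub_lt_iff_lt_add', div_lt_iff₀ (by linarith)] at hγ2
    linarith

/-- A three-term Young inequality adapted to the energy estimate. -/
theorem exists_young_bound {p γ σ e K ε : ℝ} (hσ : p - 1 < σ) (hγ : 1 ≤ γ)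
    (he : 0 < e) (hep : e ≤ p) (hK : p * (σ + γ) / (σ - p + 1) ≤ K) (hε : 0 < ε) :
    ∃ C : ℝ, ∀ t b s g : ℝ, 0 ≤ t → 0 ≤ b → 0 ≤ s → s ≤ 1 → 0 ≤ g →
      t ^ (p - e) * b ^ (γ - 1 + e) * s ^ (K - e) * g ^ e ≤
        ε * (t ^ p * b ^ (γ - 1) * s ^ K) + ε * (b ^ (σ + γ) * s ^ K) +
          C * g ^ (p * (σ + γ) / (σ - p + 1)) := by
  have hp : 0 < p := by linarith
  have hτ : 0 < σ - p + 1 := by linarith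
  have hN : 0 < σ + γ := by linarith
  have hn : 0 < γ + p - 1 := by linarith
  set α := p * (σ + γ) / (σ - p + 1) with hα
  have hα0 : 0 < α := by positivity
  set w₁ := (p - e) / p with hw₁
  set w₂ := e * (γ + p - 1) / (p * (σ + γ)) with hw₂
  set w₃ := e / α with hw₃
  have h1 : 0 ≤ w₁ := div_nonneg (by linarith) hp.le
  have h2 : 0 < w₂ := by positivity
  have h3 : 0 < w₃ := by positivity
  have hsum : w₁ + w₂ + w₃ = 1 := by
    rw [hw₁, hw₂, hw₃, hα]
    field_simp
    ring
  have hK0 : 0 < K := hα0.trans_le hK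
  have heK : e ≤ K * w₃ := by
    rw [hw₃, mul_div_assoc', le_div_iff₀ hα0]
    nlinarith
  refine ⟨ε ^ (-((w₁ + w₂) / w₃)), fun t b s g ht hb hs hs1 hg ↦ ?_⟩
  set D := ε ^ (-((w₁ + w₂) / w₃)) with hD
  have hD0 : 0 < D := by positivity
  have hεD : ε ^ w₁ * ε ^ w₂ * D ^ w₃ = 1 := by
    rw [hD, ← Real.rpow_mul hε.le, ← Real.rpow_add hε, ← Real.rpow_add hε]
    have : w₁ + w₂ + -((w₁ + w₂) / w₃) * w₃ = 0 := by field_simp; ring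
    rw [this, Real.rpow_zero]
  have amgm := Real.geom_mean_le_arith_mean3_weighted h1 h2.le h3.le
    (p₁ := ε * (t ^ p * b ^ (γ - 1) * s ^ K)) (p₂ := ε * (b ^ (σ + γ) * s ^ K))
    (p₃ := D * g ^ α) (by positivity) (by positivity) (by positivity) hsum
  have hprod : (ε * (t ^ p * b ^ (γ - 1) * s ^ K)) ^ w₁ * (ε * (b ^ (σ + γ) * s ^ K)) ^ w₂ *
      (D * g ^ α) ^ w₃ = t ^ (p - e) * b ^ (γ - 1 + e) * s ^ (K * (w₁ + w₂)) * g ^ e := by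
    have et : (t ^ p) ^ w₁ = t ^ (p - e) := by
      rw [← Real.rpow_mul ht]; congr 1; rw [hw₁]; field_simp
    have eg : (g ^ α) ^ w₃ = g ^ e := by
      rw [← Real.rpow_mul hg]; congr 1; rw [hw₃]; field_simp
    have eb : (b ^ (γ - 1)) ^ w₁ * (b ^ (σ + γ)) ^ w₂ = b ^ (γ - 1 + e) := by
      rw [← Real.rpow_mul hb, ← Real.rpow_mul hb, ← Real.rpow_add_of_nonneg hb
        (mul_nonneg (by linarith) h1) (by positivity)]
      congr 1
      rw [hw₁, hw₂]
      field_simp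
      ring
    have es : (s ^ K) ^ w₁ * (s ^ K) ^ w₂ = s ^ (K * (w₁ + w₂)) := by
      rw [← Real.rpow_mul hs, ← Real.rpow_mul hs, ← Real.rpow_add_of_nonneg hs
        (by positivity) (by positivity), mul_add]
    rw [Real.mul_rpow hε.le (by positivity), Real.mul_rpow (by positivity) (by positivity),
      Real.mul_rpow (by positivity) (by positivity), Real.mul_rpow hε.le (by positivity),
      Real.mul_rpow (by positivity) (by positivity), Real.mul_rpow hD0.le (by positivity),
      ← et, ← eg, ← eb, ← es]
    linear_combination ((t ^ p) ^ w₁ * ((b ^ (γ - 1)) ^ w₁ * (b ^ (σ + γ)) ^ w₂) *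
      ((s ^ K) ^ w₁ * (s ^ K) ^ w₂) * (g ^ α) ^ w₃) * hεD
  have hKe : K * (w₁ + w₂) ≤ K - e := by
    have : w₁ + w₂ = 1 - w₃ := by linarith
    rw [this]
    linarith
  have hspow : s ^ (K - e) ≤ s ^ (K * (w₁ + w₂)) :=
    Real.rpow_le_rpow_of_exponent_ge_of_imp hs hs1 hKe fun _ h ↦ by
      have : 0 < K * (w₁ + w₂) := by positivity
      linarith
  calc t ^ (p - e) * b ^ (γ - 1 + e) * s ^ (K - e) * g ^ e
      ≤ t ^ (p - e) * b ^ (γ - 1 + e) * s ^ (K * (w₁ + w₂)) * g ^ e := by gcongr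
    _ ≤ _ := hprod.symm.le.trans amgm
    _ ≤ 1 * (ε * (t ^ p * b ^ (γ - 1) * s ^ K)) + 1 * (ε * (b ^ (σ + γ) * s ^ K)) +
          1 * (D * g ^ α) := by
        gcongr <;> linarith
    _ = _ := by ring

/-- The signed power `t ↦ |t| ^ (c - 1) t` is differentiable for `c > 1`. -/
theorem hasDerivAt_abs_rpow_mul_self_s3 {c : ℝ} (hc : 1 < c) (t : ℝ) :
    HasDerivAt (fun t : ℝ ↦ |t| ^ (c - 1) * t) (c * |t| ^ (c - 1)) t := by
  rcases eq_or_ne t 0 with rfl | ht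
  · have h0 : c * |(0 : ℝ)| ^ (c - 1) = 0 := by
      rw [abs_zero, Real.zero_rpow (by linarith), mul_zero]
    rw [h0, hasDerivAt_iff_tendsto_slope_zero]
    have hcont : Continuous fun t : ℝ ↦ |t| ^ (c - 1) :=
      continuous_abs.rpow_const fun _ ↦ Or.inr (by linarith)
    have hlim := (hcont.tendsto 0).mono_left (nhdsWithin_le_nhds (s := {0}ᶜ))
    rw [abs_zero, Real.zero_rpow (by linarith)] at hlim
    refine hlim.congr' ?_
    filter_upwards [self_mem_nhdsWithin] with t ht
    have ht : t ≠ 0 := ht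
    simp only [zero_add, mul_zero, sub_zero, smul_eq_mul]
    field_simp
  · have h := ((hasDerivAt_abs ht).rpow_const (p := c - 1) (Or.inl (abs_ne_zero.2 ht))).mul
      (hasDerivAt_id t)
    refine h.congr_deriv ?_
    have hsign : (SignType.sign t : ℝ) * t = |t| := sign_mul_self t
    have hpow : |t| ^ (c - 1 - 1) * |t| = |t| ^ (c - 1) := by
      rw [Real.rpow_sub_one (abs_ne_zero.2 ht)]
      field_simp [abs_ne_zero.2 ht]
    simp only [id_eq, mul_one]
    rw [← hpow, ← hsign]
    ring

theorem contDiff_abs_rpow_mul_self_s3 {c : ℝ} (hc : 1 < c) :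
    ContDiff ℝ 1 fun t : ℝ ↦ |t| ^ (c - 1) * t := by
  refine contDiff_one_iff_deriv.2
    ⟨fun t ↦ (hasDerivAt_abs_rpow_mul_self_s3 hc t).differentiableAt, ?_⟩
  rw [funext fun t ↦ (hasDerivAt_abs_rpow_mul_self_s3 hc t).deriv]
  exact continuous_const.mul (continuous_abs.rpow_const fun _ ↦ Or.inr (by linarith))

open scoped Topology

section Gradient

variable {m : ℕ} {f u ψ : Em m → ℝ}

theorem continuous_gradient_s3 (hf : ContDiff ℝ 1 f) : Continuous (gradient f) :=
  (InnerProductSpace.toDual ℝ (Em m)).symm.continuous.comp (hf.continuous_fderiv one_ne_zero)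

theorem hasCompactSupport_gradient (hf : HasCompactSupport f) :
    HasCompactSupport (gradient f) :=
  (hf.fderiv ℝ).comp_left (g := (InnerProductSpace.toDual ℝ (Em m)).symm) (map_zero _)

theorem norm_gradient (x : Em m) : ‖gradient f x‖ = ‖fderiv ℝ f x‖ :=
  (InnerProductSpace.toDual ℝ (Em m)).symm.norm_map _

theorem gradient_signedPow_mul_pow {c : ℝ} (hc : 1 < c) (hu : ContDiff ℝ 1 u)
    (hψ : ContDiff ℝ 1 ψ) (n : ℕ) (x : Em m) :
    gradient (fun x ↦ |u x| ^ (c - 1) * u x * ψ x ^ n) x =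
      (c * |u x| ^ (c - 1) * ψ x ^ n) • gradient u x +
        (|u x| ^ (c - 1) * u x * (n * ψ x ^ (n - 1))) • gradient ψ x := by
  have h1 : HasFDerivAt (fun x ↦ |u x| ^ (c - 1) * u x)
      ((c * |u x| ^ (c - 1)) • fderiv ℝ u x) x :=
    (hasDerivAt_abs_rpow_mul_self_s3 hc (u x)).comp_hasFDerivAt x
      (hu.differentiable one_ne_zero x).hasFDerivAt
  have h2 := (hψ.differentiable one_ne_zero x).hasFDerivAt.pow n
  have h3 := (h1.mul h2).fderiv
  unfold gradient
  rw [show (fun x ↦ |u x| ^ (c - 1) * u x * ψ x ^ n) =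
    (fun x ↦ |u x| ^ (c - 1) * u x) * ψ ^ n from rfl]
  refine (congrArg _ h3).trans ?_
  simp only [map_add, map_smul, smul_smul, nsmul_eq_mul]
  rw [add_comm]
  congr 2
  ring

theorem contDiff_signedPow_mul_pow {c : ℝ} (hc : 1 < c) (hu : ContDiff ℝ 1 u)
    (hψ : ContDiff ℝ 1 ψ) (n : ℕ) :
    ContDiff ℝ 1 fun x ↦ |u x| ^ (c - 1) * u x * ψ x ^ n :=
  ((contDiff_abs_rpow_mul_self_s3 hc).comp hu).mul (hψ.pow n)

theorem hasCompactSupport_mul_pow (f : Em m → ℝ) (hψ : HasCompactSupport ψ) {n : ℕ}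
    (hn : n ≠ 0) : HasCompactSupport fun x ↦ f x * ψ x ^ n :=
  (hψ.comp_left (g := fun t ↦ t ^ n) (zero_pow hn)).mul_left (f := f)

theorem lipCS_signedPow_mul_pow {c : ℝ} (hc : 1 < c) (hu : ContDiff ℝ 1 u)
    (hψ : ContDiff ℝ 1 ψ) (hψs : HasCompactSupport ψ) {n : ℕ} (hn : n ≠ 0) :
    LipCS fun x ↦ |u x| ^ (c - 1) * u x * ψ x ^ n :=
  have hs := hasCompactSupport_mul_pow (fun x ↦ |u x| ^ (c - 1) * u x) hψs hn
  ⟨(contDiff_signedPow_mul_pow hc hu hψ n).lipschitzWith_of_hasCompactSupport hs one_ne_zero, hs⟩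

end Gradient

section Energy

variable {m : ℕ} {p σ γ : ℝ} {u : Em m → ℝ}

/-- The stability inequality with the anisotropic term absorbed by Cauchy–Schwarz. -/
theorem IsStable.le_isotropic (hp : 2 ≤ p) (hu : ContDiff ℝ 1 u)
    (hst : IsStable p σ (fun _ ↦ (1 : ℝ)) u) {φ : Em m → ℝ} (hφ : ContDiff ℝ 1 φ)
    (hφs : HasCompactSupport φ) :
    σ * ∫ x, |u x| ^ (σ - 1) * φ x ^ 2 ≤
      (p - 1) * ∫ x, ‖gradient u x‖ ^ (p - 2) * ‖gradient φ x‖ ^ 2 := by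
  have h := hst φ ⟨hφ.lipschitzWith_of_hasCompactSupport hφs one_ne_zero, hφs⟩
  simp only [one_mul] at h
  have hint : Integrable fun x ↦ ‖gradient u x‖ ^ (p - 2) * ‖gradient φ x‖ ^ 2 := by
    refine Continuous.integrable_of_hasCompactSupport ?_ ?_
    · exact ((continuous_gradient_s3 hu).norm.rpow_const fun _ ↦ Or.inr (by linarith)).mul
        ((continuous_gradient_s3 hφ).norm.pow 2)
    · exact ((hasCompactSupport_gradient hφs).comp_left (g := fun v ↦ ‖v‖ ^ 2)
        (by simp)).mul_left
  have hle : ∫ x, ‖gradient u x‖ ^ (p - 4) * ⟪gradient u x, gradient φ x⟫ ^ 2 ≤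
      ∫ x, ‖gradient u x‖ ^ (p - 2) * ‖gradient φ x‖ ^ 2 := by
    refine integral_mono_of_nonneg (ae_of_all _ fun x ↦ by positivity) hint
      (ae_of_all _ fun x ↦ ?_)
    dsimp only
    rcases eq_or_ne (gradient u x) 0 with h0 | h0
    · rw [h0, inner_zero_left, zero_pow two_ne_zero, mul_zero]
      positivity
    · have hpos : 0 < ‖gradient u x‖ := norm_pos_iff.2 h0
      have hsq : ⟪gradient u x, gradient φ x⟫ ^ 2 ≤
          (‖gradient u x‖ * ‖gradient φ x‖) ^ 2 :=
        sq_le_sq' (neg_le_of_abs_le (abs_real_inner_le_norm _ _)) (real_inner_le_norm _ _)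
      have hpow : ‖gradient u x‖ ^ (p - 2) = ‖gradient u x‖ ^ (p - 4) * ‖gradient u x‖ ^ 2 := by
        rw [← Real.rpow_two, ← Real.rpow_add hpos]
        congr 1
        ring
      rw [hpow, mul_assoc, ← mul_pow]
      gcongr
  nlinarith [mul_le_mul_of_nonneg_left hle (show 0 ≤ p - 2 by linarith)]

theorem rpow_sub_two_mul_sq {t : ℝ} (ht : 0 ≤ t) (hp : 2 ≤ p) :
    t ^ (p - 2) * t ^ 2 = t ^ p := by
  rw [← Real.rpow_two, ← Real.rpow_add_of_nonneg ht (by linarith) zero_le_two]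
  congr 1
  ring

theorem rpow_sub_two_mul_self {t : ℝ} (ht : 0 ≤ t) (hp : 2 ≤ p) :
    t ^ (p - 2) * t = t ^ (p - 1) := by
  nth_rw 2 [← Real.rpow_one t]
  rw [← Real.rpow_add_of_nonneg ht (by linarith) zero_le_one]
  congr 1
  ring

/-- Caccioppoli-type estimate for stable solutions: the weighted `L^(σ+γ)` norm is controlled by
the cutoff alone. -/
theorem exists_integral_le_of_stable (hp : 2 ≤ p) (hσ : p - 1 < σ) (hγ : 1 < γ)
    (hγσ : (p - 1) * ((γ + 1) / 2) ^ 2 < σ * γ)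
    (hu : IsWeakSol p σ (fun _ ↦ (1 : ℝ)) u) (hst : IsStable p σ (fun _ ↦ (1 : ℝ)) u) (j : ℕ)
    (hj : p * (σ + γ) / (σ - p + 1) ≤ ((2 * (j + 1) : ℕ) : ℝ)) :
    ∃ C : ℝ, ∀ ψ : Em m → ℝ, ContDiff ℝ 1 ψ → HasCompactSupport ψ → (∀ x, 0 ≤ ψ x) →
      (∀ x, ψ x ≤ 1) →
      ∫ x, |u x| ^ (σ + γ) * ψ x ^ (2 * (j + 1)) ≤
        C * ∫ x, ‖gradient ψ x‖ ^ (p * (σ + γ) / (σ - p + 1)) := by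
  obtain ⟨huC, -, -, hweak⟩ := hu
  have hα0 : 0 < p * (σ + γ) / (σ - p + 1) :=
    div_pos (mul_pos (by linarith) (by linarith)) (by linarith)
  set α := p * (σ + γ) / (σ - p + 1) with hα
  set a := (γ + 1) / 2 with ha
  have ha1 : 1 < a := by linarith
  set k : ℝ := (j : ℝ) + 1 with hk
  have hk0 : 0 < k := by positivity
  set c := 2 * a * k + k ^ 2 with hc
  obtain ⟨ε, hε0, hεγ, hεf⟩ : ∃ ε : ℝ, 0 < ε ∧ 0 < γ - 2 * k * ε ∧
      0 < σ * (γ - 2 * k * ε) -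
        (p - 1) * ((a ^ 2 + c * ε) * (1 + 2 * k * ε) + c * ε * (γ - 2 * k * ε)) := by
    have h1 : ∀ᶠ ε : ℝ in 𝓝 0, 0 < γ - 2 * k * ε :=
      (show Continuous fun ε : ℝ ↦ γ - 2 * k * ε by fun_prop).continuousAt.eventually_const_lt
        (by simp; linarith)
    have h2 : ∀ᶠ ε : ℝ in 𝓝 0, 0 < σ * (γ - 2 * k * ε) -
        (p - 1) * ((a ^ 2 + c * ε) * (1 + 2 * k * ε) + c * ε * (γ - 2 * k * ε)) :=
      (show Continuous fun ε : ℝ ↦ σ * (γ - 2 * k * ε) -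
        (p - 1) * ((a ^ 2 + c * ε) * (1 + 2 * k * ε) + c * ε * (γ - 2 * k * ε))
          by fun_prop).continuousAt.eventually_const_lt (by simp; linarith)
    obtain ⟨ε, ⟨h1, h2⟩, h0⟩ :=
      (((h1.and h2).filter_mono nhdsWithin_le_nhds).and
        (self_mem_nhdsWithin (s := Ioi (0 : ℝ)))).exists
    exact ⟨ε, h0, h1, h2⟩
  obtain ⟨C₁, young₁⟩ := exists_young_bound (e := 1) hσ hγ.le one_pos (by linarith) hj hε0
  obtain ⟨C₂, young₂⟩ := exists_young_bound (e := 2) hσ hγ.le two_pos hp hj hε0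
  have hK1 : ((2 * (j + 1) : ℕ) : ℝ) - 1 = ((2 * j + 1 : ℕ) : ℝ) := by push_cast; ring
  have hK2 : ((2 * (j + 1) : ℕ) : ℝ) - 2 = ((2 * j : ℕ) : ℝ) := by push_cast; ring
  simp only [hK1, hK2, Real.rpow_natCast, Real.rpow_one, Real.rpow_two, sub_add_cancel,
    ← hα] at young₁ young₂
  set h := γ - 2 * k * ε with hh
  set F := σ * h - (p - 1) * ((a ^ 2 + c * ε) * (1 + 2 * k * ε) + c * ε * h) with hF
  refine ⟨((p - 1) * (a ^ 2 + c * ε) * (2 * k * C₁) +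
    (p - 1) * h * (2 * a * k * C₁ + k ^ 2 * C₂)) / F, fun ψ hψ hψs hψ0 hψ1 ↦ ?_⟩
  have hGc := continuous_gradient_s3 huC
  have huc := huC.continuous
  have hψc := hψ.continuous
  have hbσ : ∀ x, |u x| ^ (σ + γ) = |u x| ^ (σ - 1) * |u x| ^ (γ - 1) * u x ^ 2 := fun x ↦ by
    have hb := abs_nonneg (u x)
    rw [← sq_abs (u x), ← Real.rpow_two, ← Real.rpow_add_of_nonneg hb (by linarith)
      (by linarith), ← Real.rpow_add_of_nonneg hb (by linarith) zero_le_two]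
    congr 1
    ring
  have hbγ : ∀ x, |u x| ^ γ = |u x| ^ (γ - 1) * |u x| := fun x ↦ by
    nth_rw 3 [← Real.rpow_one |u x|]
    rw [← Real.rpow_add_of_nonneg (abs_nonneg _) (by linarith) zero_le_one, sub_add_cancel]
  have hIntI : Integrable fun x ↦ |u x| ^ (σ + γ) * ψ x ^ (2 * (j + 1)) :=
    Continuous.integrable_of_hasCompactSupport
      ((huc.abs.rpow_const fun _ ↦ Or.inr (by linarith)).mul (hψc.pow _))
      (hasCompactSupport_mul_pow _ hψs (by simp))
  have hIntA : Integrable fun x ↦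
      ‖gradient u x‖ ^ p * |u x| ^ (γ - 1) * ψ x ^ (2 * (j + 1)) :=
    Continuous.integrable_of_hasCompactSupport
      (((hGc.norm.rpow_const fun _ ↦ Or.inr (by linarith)).mul
        (huc.abs.rpow_const fun _ ↦ Or.inr (by linarith))).mul (hψc.pow _))
      (hasCompactSupport_mul_pow _ hψs (by simp))
  have hIntD : Integrable fun x ↦ ‖gradient ψ x‖ ^ α :=
    Continuous.integrable_of_hasCompactSupport
      ((continuous_gradient_s3 hψ).norm.rpow_const fun _ ↦ Or.inr hα0.le)
      ((hasCompactSupport_gradient hψs).comp_left (g := fun v ↦ ‖v‖ ^ α)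
        (by simp [Real.zero_rpow hα0.ne']))
  set I := ∫ x, |u x| ^ (σ + γ) * ψ x ^ (2 * (j + 1)) with hI
  set A := ∫ x, ‖gradient u x‖ ^ p * |u x| ^ (γ - 1) * ψ x ^ (2 * (j + 1)) with hA
  set D := ∫ x, ‖gradient ψ x‖ ^ α with hD
  have energy : h * A ≤ (1 + 2 * k * ε) * I + 2 * k * C₁ * D := by
    have hφ := contDiff_signedPow_mul_pow hγ huC hψ (2 * (j + 1))
    have hφs := hasCompactSupport_mul_pow (fun x ↦ |u x| ^ (γ - 1) * u x) hψs
      (n := 2 * (j + 1)) (by simp)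
    have hw := hweak _ (lipCS_signedPow_mul_pow hγ huC hψ hψs (n := 2 * (j + 1)) (by simp))
    have hrhs : ∫ x, (1 : ℝ) * |u x| ^ (σ - 1) * u x *
        (|u x| ^ (γ - 1) * u x * ψ x ^ (2 * (j + 1))) = I := by
      refine integral_congr_ae (ae_of_all _ fun x ↦ ?_)
      dsimp only
      rw [hbσ]
      ring
    rw [hrhs] at hw
    have hint : Integrable fun x ↦ ‖gradient u x‖ ^ (p - 2) *
        ⟪gradient u x, gradient (fun x ↦ |u x| ^ (γ - 1) * u x * ψ x ^ (2 * (j + 1))) x⟫ := by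
      refine Continuous.integrable_of_hasCompactSupport ?_ ?_
      · exact (hGc.norm.rpow_const fun _ ↦ Or.inr (by linarith)).mul
          (hGc.inner (continuous_gradient_s3 hφ))
      · refine (hasCompactSupport_gradient hφs).mono fun x hx h0 ↦ hx ?_
        dsimp only
        rw [h0, inner_zero_right, mul_zero]
    have hmono : ∫ x, (h * (‖gradient u x‖ ^ p * |u x| ^ (γ - 1) * ψ x ^ (2 * (j + 1))) -
        2 * k * ε * (|u x| ^ (σ + γ) * ψ x ^ (2 * (j + 1))) -
        2 * k * C₁ * ‖gradient ψ x‖ ^ α) ≤ I := by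
      rw [← hw]
      refine integral_mono (((hIntA.const_mul _).sub (hIntI.const_mul _)).sub
        (hIntD.const_mul _)) hint fun x ↦ ?_
      dsimp only
      rw [gradient_signedPow_mul_pow hγ huC hψ, inner_add_right, inner_smul_right,
        inner_smul_right, real_inner_self_eq_norm_sq]
      have hy := young₁ ‖gradient u x‖ |u x| (ψ x) ‖gradient ψ x‖ (norm_nonneg _) (abs_nonneg _)
        (hψ0 x) (hψ1 x) (norm_nonneg _)
      have ht := norm_nonneg (gradient u x)
      have hψn : 0 ≤ ψ x ^ (2 * j + 1) := pow_nonneg (hψ0 x) _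
      have hin : -(|u x| * (‖gradient u x‖ * ‖gradient ψ x‖)) ≤
          u x * ⟪gradient u x, gradient ψ x⟫ := by
        refine neg_le_of_abs_le ?_
        rw [abs_mul]
        exact mul_le_mul_of_nonneg_left (abs_real_inner_le_norm _ _) (abs_nonneg _)
      have hcoef : 0 ≤ ‖gradient u x‖ ^ (p - 2) * |u x| ^ (γ - 1) * (2 * k) *
          ψ x ^ (2 * j + 1) := by positivity
      have hin' := mul_le_mul_of_nonneg_left hin hcoef
      have hnat : 2 * (j + 1) - 1 = 2 * j + 1 := by omega
      have hcast : ((2 * (j + 1) : ℕ) : ℝ) = 2 * k := by push_cast; ring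
      rw [hnat, hcast]
      rw [hbγ, ← rpow_sub_two_mul_self ht hp] at hy
      rw [← rpow_sub_two_mul_sq ht hp] at hy ⊢
      have hy' := mul_le_mul_of_nonneg_left hy (show 0 ≤ 2 * k by positivity)
      rw [hh]
      linarith only [hy', hin']
    rw [integral_sub ((hIntA.const_mul _).sub' (hIntI.const_mul _)) (hIntD.const_mul _),
      integral_sub (hIntA.const_mul _) (hIntI.const_mul _), integral_const_mul,
      integral_const_mul, integral_const_mul, ← hA, ← hI, ← hD] at hmono
    linarith
  have stab : σ * I ≤ (p - 1) * ((a ^ 2 + c * ε) * A + c * ε * I +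
      (2 * a * k * C₁ + k ^ 2 * C₂) * D) := by
    have hφ := contDiff_signedPow_mul_pow ha1 huC hψ (j + 1)
    have hφs := hasCompactSupport_mul_pow (fun x ↦ |u x| ^ (a - 1) * u x) hψs
      (n := j + 1) (by simp)
    have hs := hst.le_isotropic hp huC hφ hφs
    have hβ : ∀ x, (|u x| ^ (a - 1)) ^ 2 = |u x| ^ (γ - 1) := fun x ↦ by
      rw [← Real.rpow_two, ← Real.rpow_mul (abs_nonneg _)]
      congr 1
      rw [ha]
      ring
    have hlhs : ∫ x, |u x| ^ (σ - 1) * (|u x| ^ (a - 1) * u x * ψ x ^ (j + 1)) ^ 2 = I := by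
      refine integral_congr_ae (ae_of_all _ fun x ↦ ?_)
      dsimp only
      rw [hbσ, ← hβ]
      ring
    rw [hlhs] at hs
    refine hs.trans (mul_le_mul_of_nonneg_left ?_ (by linarith))
    have hmono : ∫ x, ‖gradient u x‖ ^ (p - 2) *
        ‖gradient (fun x ↦ |u x| ^ (a - 1) * u x * ψ x ^ (j + 1)) x‖ ^ 2 ≤
        ∫ x, ((a ^ 2 + c * ε) * (‖gradient u x‖ ^ p * |u x| ^ (γ - 1) * ψ x ^ (2 * (j + 1))) +
          c * ε * (|u x| ^ (σ + γ) * ψ x ^ (2 * (j + 1))) +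
          (2 * a * k * C₁ + k ^ 2 * C₂) * ‖gradient ψ x‖ ^ α) := by
      refine integral_mono_of_nonneg (ae_of_all _ fun x ↦ by positivity)
        (((hIntA.const_mul _).add (hIntI.const_mul _)).add (hIntD.const_mul _))
        (ae_of_all _ fun x ↦ ?_)
      dsimp only
      have hy₁ := young₁ ‖gradient u x‖ |u x| (ψ x) ‖gradient ψ x‖ (norm_nonneg _)
        (abs_nonneg _) (hψ0 x) (hψ1 x) (norm_nonneg _)
      have hy₂ := young₂ ‖gradient u x‖ |u x| (ψ x) ‖gradient ψ x‖ (norm_nonneg _)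
        (abs_nonneg _) (hψ0 x) (hψ1 x) (norm_nonneg _)
      have ht := norm_nonneg (gradient u x)
      have hx0 := hψ0 x
      have hb2 : |u x| ^ (γ - 1 + 2) = |u x| ^ (γ - 1) * |u x| ^ 2 := by
        rw [← Real.rpow_two, ← Real.rpow_add_of_nonneg (abs_nonneg _) (by linarith) zero_le_two]
      have hnorm : ‖gradient (fun x ↦ |u x| ^ (a - 1) * u x * ψ x ^ (j + 1)) x‖ ≤
          a * |u x| ^ (a - 1) * ψ x ^ (j + 1) * ‖gradient u x‖ +
            |u x| ^ (a - 1) * |u x| * (k * ψ x ^ j) * ‖gradient ψ x‖ := by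
        rw [gradient_signedPow_mul_pow ha1 huC hψ]
        refine (norm_add_le _ _).trans (le_of_eq ?_)
        have h1 : 0 ≤ |u x| ^ (a - 1) := by positivity
        rw [norm_smul, norm_smul, Real.norm_eq_abs, Real.norm_eq_abs,
          abs_of_nonneg (show 0 ≤ a * |u x| ^ (a - 1) * ψ x ^ (j + 1) by positivity),
          abs_mul, abs_mul _ (u x), abs_of_nonneg h1, Nat.cast_succ, ← hk,
          Nat.add_sub_cancel, abs_of_nonneg (show 0 ≤ k * ψ x ^ j by positivity)]
      have hsq := mul_le_mul_of_nonneg_left (pow_le_pow_left₀ (norm_nonneg _) hnorm 2)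
        (show 0 ≤ ‖gradient u x‖ ^ (p - 2) by positivity)
      refine hsq.trans ?_
      have hexp : ‖gradient u x‖ ^ (p - 2) *
          (a * |u x| ^ (a - 1) * ψ x ^ (j + 1) * ‖gradient u x‖ +
            |u x| ^ (a - 1) * |u x| * (k * ψ x ^ j) * ‖gradient ψ x‖) ^ 2 =
          a ^ 2 * (‖gradient u x‖ ^ p * |u x| ^ (γ - 1) * ψ x ^ (2 * (j + 1))) +
          2 * a * k * (‖gradient u x‖ ^ (p - 1) * |u x| ^ γ * ψ x ^ (2 * j + 1) *
            ‖gradient ψ x‖) +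
          k ^ 2 * (‖gradient u x‖ ^ (p - 2) * |u x| ^ (γ - 1 + 2) * ψ x ^ (2 * j) *
            ‖gradient ψ x‖ ^ 2) := by
        rw [hbγ, hb2, ← rpow_sub_two_mul_self ht hp, ← rpow_sub_two_mul_sq ht hp, ← hβ]
        ring
      rw [hexp, hc]
      have hy₁' := mul_le_mul_of_nonneg_left hy₁ (show 0 ≤ 2 * a * k by positivity)
      have hy₂' := mul_le_mul_of_nonneg_left hy₂ (show 0 ≤ k ^ 2 by positivity)
      linarith only [hy₁', hy₂']
    rw [integral_add ((hIntA.const_mul _).fun_add (hIntI.const_mul _)) (hIntD.const_mul _),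
      integral_add (hIntA.const_mul _) (hIntI.const_mul _), integral_const_mul,
      integral_const_mul, integral_const_mul, ← hA, ← hI, ← hD] at hmono
    exact hmono
  rw [div_mul_eq_mul_div, le_div_iff₀ hεf]
  have hc0 : 0 ≤ c := by positivity
  have e1 := mul_le_mul_of_nonneg_left energy
    (show 0 ≤ (p - 1) * (a ^ 2 + c * ε) from mul_nonneg (by linarith) (by positivity))
  have e2 := mul_le_mul_of_nonneg_left stab hεγ.le
  rw [hF]
  linarith only [e1, e2]

end Energy

/-- The right-hand side of the energy estimate decays under dilation of the cutoff. -/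
theorem integral_norm_gradient_comp_inv_smul {m : ℕ} {ψ : Em m → ℝ} {α R : ℝ} (hR : 0 < R) :
    ∫ x, ‖gradient (fun x ↦ ψ (R⁻¹ • x)) x‖ ^ α =
      R ^ ((m : ℝ) - α) * ∫ x, ‖gradient ψ x‖ ^ α := by
  have hgrad : ∀ x, ‖gradient (fun x ↦ ψ (R⁻¹ • x)) x‖ ^ α =
      R ^ (-α) * ‖gradient ψ (R⁻¹ • x)‖ ^ α := fun x ↦ by
    rw [norm_gradient, norm_gradient, fderiv_comp_smul, norm_smul, Real.norm_eq_abs,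
      abs_of_pos (inv_pos.2 hR), Real.mul_rpow (by positivity) (norm_nonneg _),
      Real.inv_rpow hR.le, Real.rpow_neg hR.le]
  simp_rw [hgrad]
  rw [integral_const_mul,
    Measure.integral_comp_inv_smul_of_nonneg volume (fun x ↦ ‖gradient ψ x‖ ^ α) hR.le,
    finrank_euclideanSpace_fin, smul_eq_mul, ← mul_assoc, ← Real.rpow_natCast,
    ← Real.rpow_add hR]
  congr 2
  ring

theorem nonexistence_stable_V_one (m : ℕ) (hm : 1 ≤ m) (p σ : ℝ)
    (hp : 2 ≤ p) (hσ : p - 1 < σ)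
    (hcrit : (m : ℝ) ≤ p * (p + 3) / (p - 1) ∨
      ((m : ℝ) > p * (p + 3) / (p - 1) ∧ σ < sigmaC (m : ℝ) p))
    (u : Em m → ℝ) (hu : IsWeakSol p σ (fun _ => (1 : ℝ)) u)
    (hst : IsStable p σ (fun _ => (1 : ℝ)) u) :
    ∀ᵐ x : Em m, u x = 0 := by
  obtain ⟨γ, hγ, hγσ, hmα⟩ := exists_exponent hp hσ (lt_alphaC hp hσ hcrit)
  set α := p * (σ + γ) / (σ - p + 1) with hα
  obtain ⟨j, hj⟩ := exists_nat_ge α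
  have hjα : α ≤ ((2 * (j + 1) : ℕ) : ℝ) := by
    push_cast
    linarith [(Nat.cast_nonneg j : (0 : ℝ) ≤ j)]
  obtain ⟨C, hC⟩ := exists_integral_le_of_stable hp hσ hγ hγσ hu hst j hjα
  let b : ContDiffBump (0 : Em m) := ⟨1, 2, one_pos, one_lt_two⟩
  have hb1 : ∀ R : ℝ, 0 < R → ∀ x : Em m, ‖x‖ ≤ R → b (R⁻¹ • x) = 1 := fun R hR x hx ↦ by
    refine b.one_of_mem_closedBall (mem_closedBall_zero_iff.2 ?_)
    rw [norm_smul, norm_inv, Real.norm_of_nonneg hR.le, inv_mul_le_iff₀ hR]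
    simpa [b] using hx
  have hcd : ∀ R : ℝ, ContDiff ℝ 1 fun x : Em m ↦ b (R⁻¹ • x) := fun R ↦
    b.contDiff.comp (contDiff_const_smul _)
  have hcs : ∀ R : ℝ, 0 < R → HasCompactSupport fun x : Em m ↦ b (R⁻¹ • x) := fun R hR ↦
    b.hasCompactSupport.comp_smul (inv_ne_zero hR.ne')
  have hbound : ∀ R : ℝ, 0 < R → ∫ x, |u x| ^ (σ + γ) * b (R⁻¹ • x) ^ (2 * (j + 1)) ≤
      R ^ ((m : ℝ) - α) * (C * ∫ x, ‖gradient b x‖ ^ α) := fun R hR ↦ by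
    have h := hC _ (hcd R) (hcs R hR) (fun _ ↦ b.nonneg) (fun _ ↦ b.le_one)
    rw [integral_norm_gradient_comp_inv_smul hR] at h
    linarith
  have hcont : ∀ R : ℝ, Continuous fun x : Em m ↦
      |u x| ^ (σ + γ) * b (R⁻¹ • x) ^ (2 * (j + 1)) := fun R ↦
    (hu.1.continuous.abs.rpow_const fun _ ↦ Or.inr (by linarith)).mul
      ((hcd R).continuous.pow _)
  have hsupp : ∀ R : ℝ, 0 < R → HasCompactSupport fun x : Em m ↦
      |u x| ^ (σ + γ) * b (R⁻¹ • x) ^ (2 * (j + 1)) := fun R hR ↦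
    hasCompactSupport_mul_pow _ (hcs R hR) (by simp)
  refine ae_of_all _ fun x₀ ↦ ?_
  by_contra hx₀
  set r := ‖x₀‖ + 1 with hr
  have hr0 : 0 < r := by positivity
  have hpos : 0 < ∫ x, |u x| ^ (σ + γ) * b (r⁻¹ • x) ^ (2 * (j + 1)) := by
    refine (hcont r).integral_pos_of_hasCompactSupport_nonneg_nonzero (hsupp r hr0)
      (fun x ↦ mul_nonneg (by positivity) (pow_nonneg b.nonneg _)) (x := x₀) ?_
    rw [hb1 r hr0 x₀ (by linarith), one_pow, mul_one]
    exact (Real.rpow_pos_of_pos (abs_pos.2 hx₀) _).ne'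
  have hmono : ∀ R : ℝ, 2 * r ≤ R →
      ∫ x, |u x| ^ (σ + γ) * b (r⁻¹ • x) ^ (2 * (j + 1)) ≤
        R ^ ((m : ℝ) - α) * (C * ∫ x, ‖gradient b x‖ ^ α) := fun R hR ↦ by
    have hR0 : 0 < R := by linarith
    refine le_trans (integral_mono ((hcont r).integrable_of_hasCompactSupport (hsupp r hr0))
      ((hcont R).integrable_of_hasCompactSupport (hsupp R hR0)) fun x ↦ ?_) (hbound R hR0)
    refine mul_le_mul_of_nonneg_left (pow_le_pow_left₀ b.nonneg ?_ _) (by positivity)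
    rcases le_or_gt ‖x‖ R with hx | hx
    · rw [hb1 R hR0 x hx]
      exact b.le_one
    · rw [b.zero_of_le_dist]
      · exact b.nonneg
      · rw [dist_zero_right, norm_smul, norm_inv, Real.norm_of_nonneg hr0.le, inv_mul_eq_div,
          le_div_iff₀ hr0]
        exact (hR.trans_lt hx).le
  have hlim : Tendsto (fun R : ℝ ↦ R ^ ((m : ℝ) - α) * (C * ∫ x, ‖gradient b x‖ ^ α)) atTop
      (𝓝 0) := by
    have h := tendsto_rpow_neg_atTop (show 0 < α - m by linarith)
    rw [neg_sub] at h
    simpa using h.mul_const (C * ∫ x, ‖gradient b x‖ ^ α)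
  exact hpos.not_ge (ge_of_tendsto hlim ((eventually_ge_atTop (2 * r)).mono hmono))
end
end
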